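/- arXiv:math/0301341 — 2 statements merged into one kernel-verified Lean document; each statement's English description precedes it below -/
import Mathlib

section
/- Let n ≥ 1, let Ω ⊆ ℝⁿ be an open neighbourhood of 0, let b : Ω → ℝⁿ be smooth with b(0) = 0 and Db(0) = 0, let f : Ω → ℂ be smooth with f(0) = 0, let g : Ω → ℂ be smooth, and let j ≥ 1 be an integer. Then there exist r > 0 with B(0,r) ⊆ Ω and a smooth function a : B(0,r) → ℂ satisfying Σ_{i=1}^{n} (z_i + b_i(z))·∂a/∂z_i(z) + j·a(z) = f(z)·a(z) + g(z) for all z ∈ B(0,r); moreover any two smooth solutions on B(0,r) agree on a smaller ball around 0 (necessarily a(0) = g(0)/j). -/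
open Set

open scoped unitInterval ContDiff

section PathSpace

universe u

variable {K : Type*} [TopologicalSpace K] [CompactSpace K]
  {E F : Type u} [NormedAddCommGroup E] [NormedSpace ℝ E] [NormedAddCommGroup F] [NormedSpace ℝ F]

/-- Pointwise application of a family of continuous linear maps to a continuous map. -/
noncomputable def pointwiseCLM (K : Type*) [TopologicalSpace K] [CompactSpace K]
    (E F : Type u) [NormedAddCommGroup E] [NormedSpace ℝ E] [NormedAddCommGroup F]
    [NormedSpace ℝ F] : C(K, E →L[ℝ] F) →L[ℝ] C(K, E) →L[ℝ] C(K, F) :=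
  LinearMap.mkContinuous₂
    (LinearMap.mk₂ ℝ
      (fun (A : C(K, E →L[ℝ] F)) (h : C(K, E)) =>
        (⟨fun s => A s (h s), A.continuous.clm_apply h.continuous⟩ : C(K, F)))
      (fun _ _ _ => by ext; simp) (fun _ _ _ => by ext; simp)
      (fun _ _ _ => by ext; simp) (fun _ _ _ => by ext; simp)) 1
    (fun A h => by
      rw [ContinuousMap.norm_le _ (by positivity)]
      intro s
      rw [one_mul]
      exact ((A s).le_opNorm _).trans (mul_le_mul (A.norm_coe_le_norm s) (h.norm_coe_le_norm s)
        (norm_nonneg _) ((norm_nonneg _).trans (A.norm_coe_le_norm s))))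

@[simp]
theorem pointwiseCLM_apply (A : C(K, E →L[ℝ] F)) (h : C(K, E)) (s : K) :
    pointwiseCLM K E F A h s = A s (h s) := rfl

theorem hasFDerivAt_postcomp (φ : C(E, F)) (φ' : C(E, E →L[ℝ] F))
    (hφ : ∀ x, HasFDerivAt φ (φ' x) x) (u : C(K, E)) :
    HasFDerivAt (fun v : C(K, E) => φ.comp v) (pointwiseCLM K E F (φ'.comp u)) u := by
  rw [hasFDerivAt_iff_isLittleO, Asymptotics.isLittleO_iff]
  intro ε hε
  have hc : Continuous fun v : C(K, E) => φ'.comp v := φ'.continuous_postcomp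
  obtain ⟨δ, hδ, H⟩ := (Metric.continuous_iff (α := C(K, E)) (β := C(K, E →L[ℝ] F))).1 hc u ε hε
  filter_upwards [Metric.ball_mem_nhds u hδ] with w hw
  rw [ContinuousMap.norm_le _ (by positivity)]
  intro s
  have key : ‖φ (w s) - φ (u s) - φ' (u s) (w s - u s)‖ ≤ ε * ‖w s - u s‖ := by
    refine (convex_segment (u s) (w s)).norm_image_sub_le_of_norm_hasFDerivWithin_le'
      (fun x _ => (hφ x).hasFDerivWithinAt) ?_ (left_mem_segment ℝ _ _) (right_mem_segment ℝ _ _)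
    intro y hy
    rw [segment_eq_image'] at hy
    obtain ⟨t, ht, rfl⟩ := hy
    have hv : dist (u + t • (w - u)) u < δ := by
      rw [dist_eq_norm, add_sub_cancel_left, norm_smul, Real.norm_of_nonneg ht.1, ← dist_eq_norm]
      exact (mul_le_of_le_one_left dist_nonneg ht.2).trans_lt hw
    have h1 := (ContinuousMap.dist_apply_le_dist s).trans (H _ hv).le
    rw [dist_eq_norm] at h1
    exact h1
  exact key.trans (by gcongr; exact (w - u).norm_coe_le_norm s)

theorem contDiff_postcomp (φ : C(E, F)) (hφ : ContDiff ℝ ∞ φ) :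
    ContDiff ℝ ∞ (fun u : C(K, E) => φ.comp u) := by
  rw [contDiff_infty]
  intro n
  induction n generalizing F with
  | zero => exact contDiff_zero.2 (φ.continuous_postcomp)
  | succ n ih =>
    have hd : ContDiff ℝ ∞ (fderiv ℝ φ) := hφ.fderiv_right (by simp)
    push_cast
    refine contDiff_succ_iff_hasFDerivAt.2 ⟨fun u => pointwiseCLM K E F
      ((⟨fderiv ℝ φ, hd.continuous⟩ : C(E, E →L[ℝ] F)).comp u), ?_, fun u => ?_⟩
    · exact (pointwiseCLM K E F).contDiff.comp (ih ⟨_, hd.continuous⟩ hd)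
    · exact hasFDerivAt_postcomp φ ⟨_, hd.continuous⟩
        (fun x => (hφ.differentiable (by simp) x).hasFDerivAt) u

theorem ContDiff.continuousMap_prodMk {X : Type*} [NormedAddCommGroup X] [NormedSpace ℝ X]
    {p : X → C(K, E)} {q : X → C(K, F)} (hp : ContDiff ℝ ∞ p) (hq : ContDiff ℝ ∞ q) :
    ContDiff ℝ ∞ (fun x => (p x).prodMk (q x)) := by
  have : (fun x => (p x).prodMk (q x)) = fun x =>
      (ContinuousLinearMap.inl ℝ E F).compLeftContinuous ℝ K (p x)
        + (ContinuousLinearMap.inr ℝ E F).compLeftContinuous ℝ K (q x) := by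
    ext x s <;> simp
  rw [this]
  exact (ContinuousLinearMap.contDiff _ |>.comp hp).add (ContinuousLinearMap.contDiff _ |>.comp hq)

end PathSpace

section Primitive

theorem continuous_projIcc_extend {E : Type*} [TopologicalSpace E] (v : C(I, E)) :
    Continuous fun r : ℝ => v (projIcc 0 1 zero_le_one r) :=
  v.continuous.comp continuous_projIcc

variable {E : Type*} [NormedAddCommGroup E] [NormedSpace ℝ E]

/-- The primitive vanishing at `0` of the constant extension of a path on the unit interval. -/
noncomputable def pathPrimitive (v : C(I, E)) (t : ℝ) : E :=
  ∫ r in (0 : ℝ)..t, v (projIcc 0 1 zero_le_one r)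

theorem hasDerivAt_pathPrimitive [CompleteSpace E] (v : C(I, E)) (t : ℝ) :
    HasDerivAt (pathPrimitive v) (v (projIcc 0 1 zero_le_one t)) t :=
  ((continuous_projIcc_extend v).integral_hasStrictDerivAt 0 t).hasDerivAt

theorem pathPrimitive_add (v w : C(I, E)) (t : ℝ) :
    pathPrimitive (v + w) t = pathPrimitive v t + pathPrimitive w t :=
  intervalIntegral.integral_add ((continuous_projIcc_extend v).intervalIntegrable _ _)
    ((continuous_projIcc_extend w).intervalIntegrable _ _)

theorem pathPrimitive_smul (c : ℝ) (v : C(I, E)) (t : ℝ) :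
    pathPrimitive (c • v) t = c • pathPrimitive v t :=
  intervalIntegral.integral_smul _ _

theorem norm_pathPrimitive_le (v : C(I, E)) (s : I) : ‖pathPrimitive v s‖ ≤ ‖v‖ := by
  have := intervalIntegral.norm_integral_le_of_norm_le_const (a := 0) (b := (s : ℝ))
    (f := fun r => v (projIcc 0 1 zero_le_one r)) (C := ‖v‖) fun r _ => v.norm_coe_le_norm _
  refine this.trans (mul_le_of_le_one_right (norm_nonneg _) ?_)
  rw [sub_zero, abs_of_nonneg s.2.1]
  exact s.2.2

theorem pathPrimitive_mul (v w : C(I, E)) (τ : I) (h : ∀ s, w s = (τ : ℝ) • v (τ * s)) (s : I) :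
    pathPrimitive w s = pathPrimitive v (τ * s : I) := by
  have h1 : pathPrimitive w s
      = ∫ r in (0 : ℝ)..s, (τ : ℝ) • v (projIcc 0 1 zero_le_one (τ * r)) := by
    refine intervalIntegral.integral_congr fun r hr => ?_
    rw [uIcc_of_le s.2.1] at hr
    have hr' : r ∈ Icc (0 : ℝ) 1 := ⟨hr.1, hr.2.trans s.2.2⟩
    have h2 : (τ : ℝ) * r ∈ Icc (0 : ℝ) 1 := (τ * ⟨r, hr'⟩ : I).2
    simp only [h, projIcc_of_mem _ hr', projIcc_of_mem _ h2]
    rfl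
  rw [h1, intervalIntegral.integral_smul, intervalIntegral.smul_integral_comp_mul_left
    (fun r => v (projIcc 0 1 zero_le_one r)), mul_zero]
  rfl

variable (E) in
/-- The operator `pathPrimitive` as a continuous linear operator on the space of paths. -/
noncomputable def primitiveCLM [CompleteSpace E] : C(I, E) →L[ℝ] C(I, E) :=
  LinearMap.mkContinuous
    { toFun := fun v => ⟨fun s => pathPrimitive v s,
        (continuous_iff_continuousAt.2
          fun t => (hasDerivAt_pathPrimitive v t).continuousAt).comp continuous_subtype_val⟩
      map_add' := fun v w => by ext s; exact pathPrimitive_add v w s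
      map_smul' := fun c v => by ext s; exact pathPrimitive_smul c v s } 1
    (fun v => by
      rw [one_mul, ContinuousMap.norm_le _ (norm_nonneg _)]
      exact norm_pathPrimitive_le v)

@[simp]
theorem primitiveCLM_apply [CompleteSpace E] (v : C(I, E)) (s : I) :
    primitiveCLM E v s = pathPrimitive v s := rfl

end Primitive

/-- A smooth map vanishing at the origin factors smoothly through the identity. -/
theorem exists_contDiff_factor {E F : Type} [NormedAddCommGroup E] [NormedSpace ℝ E]
    [NormedAddCommGroup F] [NormedSpace ℝ F] [CompleteSpace F] {G : E → F}
    (hG : ContDiff ℝ ∞ G) (h0 : G 0 = 0) :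
    ∃ M : E → E →L[ℝ] F, ContDiff ℝ ∞ M ∧ (∀ y, G y = M y y) ∧ M 0 = fderiv ℝ G 0 := by
  have hd : ContDiff ℝ ∞ (fderiv ℝ G) := hG.fderiv_right (by simp)
  have hφ : ContDiff ℝ ∞ (fun p : ℝ × E => fderiv ℝ G (p.1 • p.2)) :=
    hd.comp (contDiff_fst.smul contDiff_snd)
  let ι : C(I, ℝ) := ⟨Subtype.val, continuous_subtype_val⟩
  let P : E → C(I, E →L[ℝ] F) := fun y =>
    (⟨_, hφ.continuous⟩ : C(ℝ × E, E →L[ℝ] F)).comp (ι.prodMk (ContinuousMap.const I y))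
  have hP : ContDiff ℝ ∞ P := (contDiff_postcomp _ hφ).comp
    (contDiff_const.continuousMap_prodMk (ContinuousLinearMap.const ℝ I (M := E)).contDiff)
  refine ⟨fun y => primitiveCLM _ (P y) 1, ?_, fun y => ?_, ?_⟩
  · exact (ContinuousMap.evalCLM ℝ (1 : I)).contDiff.comp ((primitiveCLM _).contDiff.comp hP)
  · have h1 : ∀ t : ℝ, HasDerivAt (fun t : ℝ => G (t • y)) (fderiv ℝ G (t • y) y) t := by
      intro t
      have := (hG.differentiable (by simp) (t • y)).hasFDerivAt.comp_hasDerivAt t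
        ((hasDerivAt_id t).smul_const y)
      simpa [Function.comp_def] using this
    have hc : Continuous fun t : ℝ => fderiv ℝ G (t • y) :=
      hd.continuous.comp (continuous_id.smul continuous_const)
    have h2 := intervalIntegral.integral_eq_sub_of_hasDerivAt (a := 0) (b := 1)
      (fun t _ => h1 t) ((hc.clm_apply continuous_const).intervalIntegrable _ _)
    simp only [one_smul, zero_smul, h0, sub_zero] at h2
    rw [← h2, ← ContinuousLinearMap.intervalIntegral_apply (hc.intervalIntegrable _ _)]
    change _ = pathPrimitive (P y) (1 : I) y
    congr 1
    refine intervalIntegral.integral_congr fun r hr => ?_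
    rw [uIcc_of_le zero_le_one] at hr
    simp [P, ι, projIcc_of_mem _ hr]
  · simp [pathPrimitive, P]

theorem exists_contDiffOn_local_inverse {X : Type*} [NormedAddCommGroup X] [NormedSpace ℝ X]
    [CompleteSpace X] {Ψ : X → X} (hΨ : ContDiff ℝ ∞ Ψ) (h0 : Ψ 0 = 0)
    (hd : HasFDerivAt Ψ (ContinuousLinearMap.id ℝ X) 0) :
    ∃ ε > (0 : ℝ), ∃ r > (0 : ℝ), ∃ inv : X → X, ContDiffOn ℝ ∞ inv (Metric.ball 0 r) ∧
      (∀ y ∈ Metric.ball 0 r, ‖inv y‖ < ε ∧ Ψ (inv y) = y) ∧ ∀ u, ‖u‖ < ε → inv (Ψ u) = u := by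
  have hd' : HasFDerivAt Ψ ((ContinuousLinearEquiv.refl ℝ X : X ≃L[ℝ] X) : X →L[ℝ] X) 0 := hd
  let Φ := (hΨ.contDiffAt (x := 0)).toOpenPartialHomeomorph Ψ hd' (by simp)
  have hΦ : ∀ x, Φ x = Ψ x := fun _ => rfl
  have hs : (0 : X) ∈ Φ.source := ContDiffAt.mem_toOpenPartialHomeomorph_source _ hd' _
  have ht : (0 : X) ∈ Φ.target := by simpa [hΦ, h0] using Φ.map_source hs
  have hsymm : Φ.symm 0 = 0 := by simpa [hΦ, h0] using Φ.left_inv hs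
  have hinv : {x : X | fderiv ℝ Ψ x ∈ range ((↑) : (X ≃L[ℝ] X) → X →L[ℝ] X)} ∈ nhds (0 : X) :=
    (hΨ.continuous_fderiv (by simp)).continuousAt.preimage_mem_nhds
      (ContinuousLinearEquiv.isOpen.mem_nhds ⟨.refl ℝ X, hd'.fderiv.symm⟩)
  obtain ⟨ε, hε, hεs⟩ := Metric.mem_nhds_iff.1
    (Filter.inter_mem (Φ.open_source.mem_nhds hs) hinv)
  have hball : Φ.symm ⁻¹' Metric.ball 0 ε ∈ nhds (0 : X) :=
    (Φ.symm.continuousAt ht).preimage_mem_nhds (by rw [hsymm]; exact Metric.ball_mem_nhds _ hε)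
  obtain ⟨r, hr, hrs⟩ := Metric.mem_nhds_iff.1
    (Filter.inter_mem (Φ.open_target.mem_nhds ht) hball)
  refine ⟨ε, hε, r, hr, Φ.symm, fun y hy => ?_, fun y hy => ⟨?_, ?_⟩, fun u hu => ?_⟩
  · obtain ⟨e, he⟩ := (hεs (hrs hy).2).2
    refine (Φ.contDiffAt_symm (f₀' := e) (hrs hy).1 ?_ hΨ.contDiffAt).contDiffWithinAt
    rw [he]
    exact (hΨ.differentiable (by simp) _).hasFDerivAt
  · simpa using (hrs hy).2
  · exact Φ.right_inv (hrs hy).1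
  · exact Φ.left_inv (hεs (by simpa using hu)).1

/-- Solvability of the transport equation near a zero of the vector field, global data. -/
theorem exists_transport_solution {E : Type} [NormedAddCommGroup E] [NormedSpace ℝ E]
    [CompleteSpace E] {b : E → E} {f g : E → ℂ} (hb : ContDiff ℝ ∞ b) (hf : ContDiff ℝ ∞ f)
    (hg : ContDiff ℝ ∞ g) (hb0 : b 0 = 0) (hDb : fderiv ℝ b 0 = 0) (hf0 : f 0 = 0) (k : ℕ) :
    ∃ r > (0 : ℝ), ∃ a : E → ℂ, ContDiffOn ℝ ∞ a (Metric.ball 0 r) ∧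
      ∀ z ∈ Metric.ball (0 : E) r,
        fderiv ℝ a z (z + b z) + ((k + 1 : ℕ) : ℂ) * a z = f z * a z + g z := by
  obtain ⟨B, hB, hbB, hB0⟩ := exists_contDiff_factor hb hb0
  obtain ⟨C, hC, hBC, -⟩ := exists_contDiff_factor hB (hB0.trans hDb)
  obtain ⟨D, hD, hfD, -⟩ := exists_contDiff_factor hf hf0
  let ι : C(I, ℝ) := ⟨Subtype.val, continuous_subtype_val⟩
  have hF : ContDiff ℝ ∞ (fun p : ℝ × E => C (p.1 • p.2) p.2 p.2) :=
    ((hC.comp (contDiff_fst.smul contDiff_snd)).clm_apply contDiff_snd).clm_apply contDiff_snd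
  let N : C(I, E) → C(I, E) := fun u => (⟨_, hF.continuous⟩ : C(ℝ × E, E)).comp (ι.prodMk u)
  have hN : ContDiff ℝ ∞ N :=
    (contDiff_postcomp _ hF).comp (contDiff_const.continuousMap_prodMk contDiff_id)
  have hNa : ∀ u s, N u s = C ((s : ℝ) • u s) (u s) (u s) := fun _ _ => rfl
  have hm : ContDiff ℝ ∞ (fun p : ℝ × E => D (p.1 • p.2) p.2) :=
    (hD.comp (contDiff_fst.smul contDiff_snd)).clm_apply contDiff_snd
  let m : C(I, E) → C(I, ℂ) := fun u => (⟨_, hm.continuous⟩ : C(ℝ × E, ℂ)).comp (ι.prodMk u)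
  have hmc : ContDiff ℝ ∞ m :=
    (contDiff_postcomp _ hm).comp (contDiff_const.continuousMap_prodMk contDiff_id)
  have hma : ∀ u s, m u s = D ((s : ℝ) • u s) (u s) := fun _ _ => rfl
  have hq : ContDiff ℝ ∞ (fun p : ℝ × E × ℂ =>
      (p.1 ^ k) • (Complex.exp (-p.2.2) * g (p.1 • p.2.1))) :=
    (contDiff_fst.pow k).smul ((contDiff_snd.snd.neg.cexp).mul
      (hg.comp (contDiff_fst.smul contDiff_snd.fst)))
  let p : C(I, E) → C(I, ℂ) := fun u => (⟨_, hq.continuous⟩ : C(ℝ × E × ℂ, ℂ)).comp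
    (ι.prodMk (u.prodMk (primitiveCLM ℂ (m u))))
  have hpc : ContDiff ℝ ∞ p := (contDiff_postcomp _ hq).comp
    (contDiff_const.continuousMap_prodMk
      (contDiff_id.continuousMap_prodMk ((primitiveCLM ℂ).contDiff.comp hmc)))
  have hpa : ∀ u (s : I), p u s = ((s : ℝ) ^ k) •
      (Complex.exp (-pathPrimitive (m u) s) * g ((s : ℝ) • u s)) := fun _ _ => rfl
  let A : C(I, E) → ℂ := fun u => Complex.exp (pathPrimitive (m u) 1) * pathPrimitive (p u) 1
  have hprim : ContDiff ℝ ∞ (fun v : C(I, ℂ) => pathPrimitive v 1) :=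
    (ContinuousMap.evalCLM ℝ (1 : I) ∘L primitiveCLM ℂ).contDiff
  have hA : ContDiff ℝ ∞ A := (hprim.comp hmc).cexp.mul (hprim.comp hpc)
  let T : C(I, E) →L[ℝ] C(I, E) :=
    ContinuousLinearMap.const ℝ I ∘L ContinuousMap.evalCLM ℝ (1 : I) ∘L primitiveCLM E
      - primitiveCLM E
  let Ψ : C(I, E) → C(I, E) := fun u => u + T (N u)
  have hΨa : ∀ u (s : I), Ψ u s = u s + (pathPrimitive (N u) 1 - pathPrimitive (N u) s) :=
    fun _ _ => rfl
  have hΨ : ContDiff ℝ ∞ Ψ := contDiff_id.add (T.contDiff.comp hN)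
  have hN0 : N 0 = 0 := by ext s; simp [hNa]
  have hDN : HasFDerivAt N (0 : C(I, E) →L[ℝ] C(I, E)) 0 := by
    have h1 := (hN.differentiable (by simp) 0).hasFDerivAt
    suffices h : fderiv ℝ N 0 = 0 by rwa [h] at h1
    ext h s
    have h2 : HasDerivAt (fun t : ℝ => N (t • h) s) (fderiv ℝ N 0 h s) 0 := by
      have h3 : HasDerivAt (fun t : ℝ => t • h) h 0 := by
        simpa using (hasDerivAt_id (0 : ℝ)).smul_const h
      have h4 : HasFDerivAt N (fderiv ℝ N 0) ((0 : ℝ) • h) := by rwa [zero_smul]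
      exact (ContinuousMap.evalCLM ℝ s).hasFDerivAt.comp_hasDerivAt 0
        (h4.comp_hasDerivAt (0 : ℝ) h3)
    have h5 : HasDerivAt (fun t : ℝ => t ^ 2 • C ((s : ℝ) • t • h s) (h s) (h s)) 0 0 := by
      have hc : Differentiable ℝ (fun t : ℝ => C ((s : ℝ) • t • h s) (h s) (h s)) :=
        (((hC.comp (contDiff_const.smul (contDiff_id.smul contDiff_const))).clm_apply
          contDiff_const).clm_apply contDiff_const).differentiable (n := ∞) (by simp)
      refine ((hasDerivAt_pow 2 (0 : ℝ)).smul (hc 0).hasDerivAt).congr_deriv ?_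
      simp
    refine h2.unique (h5.congr_of_eventuallyEq (.of_forall fun t => ?_))
    simp [hNa, pow_two, mul_smul]
  have hDΨ : HasFDerivAt Ψ (ContinuousLinearMap.id ℝ _) 0 := by
    have h1 := (hasFDerivAt_id (𝕜 := ℝ) (0 : C(I, E))).add (T.hasFDerivAt.comp 0 hDN)
    rw [ContinuousLinearMap.comp_zero, add_zero] at h1
    exact h1
  obtain ⟨ε, hε, r, hr, inv, hinv, hinvr, hinvl⟩ :=
    exists_contDiffOn_local_inverse hΨ (by simp [Ψ, hN0]) hDΨ
  let c : E →L[ℝ] C(I, E) := ContinuousLinearMap.const ℝ I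
  have hcball : ∀ z ∈ Metric.ball (0 : E) r, c z ∈ Metric.ball 0 r := fun z hz => by
    rw [mem_ball_zero_iff] at hz ⊢
    exact ((ContinuousMap.norm_le _ (norm_nonneg z)).2 fun _ => le_rfl).trans_lt hz
  let a : E → ℂ := fun z => A (inv (c z))
  have ha : ContDiffOn ℝ ∞ a (Metric.ball 0 r) :=
    hA.comp_contDiffOn (hinv.comp c.contDiff.contDiffOn hcball)
  refine ⟨r, hr, a, ha, fun z hz => ?_⟩
  obtain ⟨hu_norm, hu⟩ := hinvr _ (hcball z hz)
  set u := inv (c z)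
  have hus : ∀ s : I, u s + (pathPrimitive (N u) 1 - pathPrimitive (N u) s) = z := fun s => by
    rw [← hΨa, hu]; rfl
  have hu1 : u 1 = z := by simpa using hus 1
  let Z : ℝ → E := fun t => t • (z - pathPrimitive (N u) 1 + pathPrimitive (N u) t)
  have hZu : ∀ τ : I, Z τ = (τ : ℝ) • u τ := fun τ => by
    simp only [Z]
    rw [← hus τ]
    congr 1
    abel
  have hZ1 : Z 1 = z := by simp [Z]
  have hZd : HasDerivAt Z (z + b z) 1 := by
    have h1 := (hasDerivAt_id (1 : ℝ)).smul
      ((hasDerivAt_pathPrimitive (N u) 1).const_add (z - pathPrimitive (N u) 1))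
    refine h1.congr_deriv ?_
    have h2 : N u 1 = b z := by simp [hNa, hu1, hbB z, hBC z]
    rw [projIcc_right]
    change (1 : ℝ) • N u 1 + (1 : ℝ) • _ = _
    rw [h2]
    simp [add_comm]
  have hscale : ∀ τ : I, ((τ : ℝ) ^ (k + 1)) • a (Z τ)
      = Complex.exp (pathPrimitive (m u) τ) * pathPrimitive (p u) τ := by
    intro τ
    let w : C(I, E) := (τ : ℝ) • u.comp ⟨fun s => τ * s, by fun_prop⟩
    have hw : ∀ s, w s = (τ : ℝ) • u (τ * s) := fun _ => rfl
    have harg : ∀ s : I, (s : ℝ) • w s = ((τ * s : I) : ℝ) • u (τ * s) := fun s => by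
      rw [hw, smul_smul, mul_comm]; rfl
    have hNw : ∀ s : I, pathPrimitive (N w) s = (τ : ℝ) • pathPrimitive (N u) (τ * s : I) := by
      intro s
      rw [← pathPrimitive_smul]
      refine pathPrimitive_mul _ _ τ (fun s => ?_) s
      rw [ContinuousMap.smul_apply, hNa, hNa, harg, hw]
      simp
    have hmw : ∀ s : I, pathPrimitive (m w) s = pathPrimitive (m u) (τ * s : I) := by
      refine pathPrimitive_mul _ _ τ (fun s => ?_)
      rw [hma, hma, harg, hw]
      simp
    have hpw : ∀ s : I, pathPrimitive ((τ : ℝ) ^ (k + 1) • p w) s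
        = pathPrimitive (p u) (τ * s : I) := by
      refine pathPrimitive_mul _ _ τ (fun s => ?_)
      rw [ContinuousMap.smul_apply, hpa, hpa, harg, hmw, smul_smul, smul_smul]
      congr 1
      simp only [Set.Icc.coe_mul]
      ring
    have hΨw : Ψ w = c (Z τ) := by
      ext s
      have h1 := hNw 1
      rw [mul_one] at h1
      have h2 : (c (Z τ)) s = Z τ := rfl
      rw [h2, hZu, hΨa, hNw, hw]
      change _ + (pathPrimitive (N w) (1 : I) - _) = _
      rw [h1, ← smul_sub, ← smul_add]
      congr 1
      have h3 := (hus (τ * s)).trans (hus τ).symm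
      have h4 : u (τ * s) = u τ + (pathPrimitive (N u) 1 - pathPrimitive (N u) τ)
        - (pathPrimitive (N u) 1 - pathPrimitive (N u) (τ * s : I)) := by rw [← h3]; abel
      rw [h4]
      abel
    have hwn : ‖w‖ < ε := by
      refine lt_of_le_of_lt ?_ hu_norm
      rw [ContinuousMap.norm_le _ (norm_nonneg _)]
      intro s
      rw [hw, norm_smul, Real.norm_of_nonneg τ.2.1]
      exact (mul_le_of_le_one_left (norm_nonneg _) τ.2.2).trans (u.norm_coe_le_norm _)
    have haw : a (Z τ) = A w := by
      simp only [a]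
      rw [← hΨw, hinvl w hwn]
    have h1 := hmw 1
    have h2 := hpw 1
    rw [mul_one] at h1 h2
    rw [pathPrimitive_smul] at h2
    rw [haw, ← h1, ← h2]
    simp only [A, Complex.real_smul]
    change _ = _ * (_ * pathPrimitive (p w) ((1 : I) : ℝ))
    simp only [Set.Icc.coe_one]
    ring
  have had : HasFDerivAt a (fderiv ℝ a z) (Z 1) := by
    rw [hZ1]
    exact ((ha.contDiffAt (Metric.isOpen_ball.mem_nhds hz)).differentiableAt (by simp)).hasFDerivAt
  have hL : HasDerivAt (fun t : ℝ => (t ^ (k + 1)) • a (Z t))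
      (fderiv ℝ a z (z + b z) + ((k + 1 : ℕ) : ℂ) * a z) 1 := by
    have := (hasDerivAt_pow (k + 1) (1 : ℝ)).smul (had.comp_hasDerivAt (1 : ℝ) hZd)
    refine this.congr_deriv ?_
    simp [hZ1]
  have hR : HasDerivAt (fun t : ℝ => Complex.exp (pathPrimitive (m u) t) * pathPrimitive (p u) t)
      (f z * a z + g z) 1 := by
    have := (hasDerivAt_pathPrimitive (m u) 1).cexp.mul (hasDerivAt_pathPrimitive (p u) 1)
    refine this.congr_deriv ?_
    have h1 : m u 1 = f z := by simp [hma, hu1, hfD z]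
    have h2 : p u 1 = Complex.exp (-pathPrimitive (m u) 1) * g z := by simp [hpa, hu1]
    have h3 : a z = Complex.exp (pathPrimitive (m u) 1) * pathPrimitive (p u) 1 := rfl
    rw [projIcc_right]
    change Complex.exp (pathPrimitive (m u) 1) * m u 1 * pathPrimitive (p u) 1
      + Complex.exp (pathPrimitive (m u) 1) * p u 1 = _
    rw [h1, h2, h3, ← mul_assoc (Complex.exp _) (Complex.exp _), ← Complex.exp_add]
    simp
    ring
  have huniq : UniqueDiffWithinAt ℝ (Icc (0 : ℝ) 1) 1 :=
    uniqueDiffOn_Icc zero_lt_one 1 (right_mem_Icc.2 zero_le_one)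
  exact huniq.eq_deriv _ hL.hasDerivWithinAt
    (hR.hasDerivWithinAt.congr (fun t ht => hscale ⟨t, ht⟩) (hscale 1))

theorem ContDiffOn.exists_contDiff_eventuallyEq {E F : Type*} [NormedAddCommGroup E]
    [NormedSpace ℝ E] [HasContDiffBump E] [NormedAddCommGroup F] [NormedSpace ℝ F] {Ω : Set E}
    (hΩ : IsOpen Ω) {x : E} (hx : x ∈ Ω) {h : E → F} (hh : ContDiffOn ℝ ∞ h Ω) :
    ∃ H : E → F, ContDiff ℝ ∞ H ∧ H =ᶠ[nhds x] h := by
  obtain ⟨R, hR, hRΩ⟩ := Metric.mem_nhds_iff.1 (hΩ.mem_nhds hx)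
  let χ : ContDiffBump x := ⟨R / 4, R / 2, by positivity, by linarith⟩
  have hχ : tsupport χ ⊆ Ω := by
    rw [χ.tsupport_eq]
    exact (Metric.closedBall_subset_ball (by simp only [χ]; linarith)).trans hRΩ
  refine ⟨fun y => χ y • h y, contDiff_iff_contDiffAt.2 fun y => ?_, ?_⟩
  · by_cases hy : y ∈ Ω
    · exact χ.contDiff.contDiffAt.smul (hh.contDiffAt (hΩ.mem_nhds hy))
    · have h0 : χ =ᶠ[nhds y] 0 := notMem_tsupport_iff_eventuallyEq.1 fun h => hy (hχ h)
      refine (contDiffAt_const (c := (0 : F))).congr_of_eventuallyEq ?_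
      filter_upwards [h0] with w hw
      simp [hw]
  · filter_upwards [χ.eventuallyEq_one] with y hy
    simp [hy]

/-- Near a source of the vector field `z + b z`, the homogeneous transport equation has only the
zero solution, by a maximum principle on a small closed ball. -/
theorem eventually_eq_zero_of_transport {E : Type*} [NormedAddCommGroup E] [NormedSpace ℝ E]
    [ProperSpace E] {b : E → E} {f d : E → ℂ} {r c : ℝ} (hr : 0 < r) (hc : 0 < c)
    (hb : HasFDerivAt b (0 : E →L[ℝ] E) 0) (hb0 : b 0 = 0) (hf : ContinuousAt f 0) (hf0 : f 0 = 0)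
    (hd : DifferentiableOn ℝ d (Metric.ball 0 r))
    (heq : ∀ z ∈ Metric.ball (0 : E) r, fderiv ℝ d z (z + b z) + c * d z = f z * d z) :
    ∃ r' > (0 : ℝ), r' ≤ r ∧ ∀ z ∈ Metric.ball (0 : E) r', d z = 0 := by
  have h1 : ∀ᶠ z in nhds (0 : E), ‖b z‖ ≤ ‖z‖ := by
    have := (hasFDerivAt_iff_isLittleO.1 hb).bound one_pos
    simpa [hb0] using this
  have h2 : ∀ᶠ z in nhds (0 : E), ‖f z‖ < c := by
    refine hf.norm.eventually_lt_const ?_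
    simpa [hf0] using hc
  obtain ⟨ρ, hρ, H⟩ := Metric.nhds_basis_closedBall.mem_iff.1
    (((h1.and h2).and (Metric.ball_mem_nhds (0 : E) hr)))
  have hρr : Metric.closedBall (0 : E) ρ ⊆ Metric.ball 0 r := fun z hz => (H hz).2
  obtain ⟨x, hx, hmax⟩ := (isCompact_closedBall (0 : E) ρ).exists_isMaxOn
    ⟨0, Metric.mem_closedBall_self hρ.le⟩
    (f := fun z => ‖d z‖ ^ 2) ((hd.continuousOn.mono hρr).norm.pow 2)
  have hxd : HasFDerivAt d (fderiv ℝ d x) x :=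
    (hd.differentiableAt (Metric.isOpen_ball.mem_nhds (hρr hx))).hasFDerivAt
  have hcone : -(x + b x) ∈ posTangentConeAt (Metric.closedBall (0 : E) ρ) x := by
    refine mem_posTangentConeAt_of_segment_subset ((convex_closedBall _ _).segment_subset hx ?_)
    have : x + -(x + b x) = -b x := by abel
    rw [this, mem_closedBall_zero_iff, norm_neg]
    exact (H hx).1.1.trans (mem_closedBall_zero_iff.1 hx)
  have hle := hmax.localize.hasFDerivWithinAt_nonpos hxd.norm_sq.hasFDerivWithinAt hcone
  have hV : fderiv ℝ d x (-(x + b x)) = (c - f x) * d x := by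
    rw [map_neg]
    linear_combination -heq x (hρr hx)
  have hle' : (c - (f x).re) * ‖d x‖ ^ 2 ≤ 0 := by
    have h3 : inner ℝ (d x) ((c - f x) * d x) ≤ 0 := by
      have : 2 * inner ℝ (d x) (fderiv ℝ d x (-(x + b x))) ≤ 0 := by
        rw [two_mul]
        rw [two_smul] at hle
        exact hle
      rw [hV] at this
      linarith
    rw [Complex.inner] at h3
    rw [Complex.sq_norm, Complex.normSq_apply]
    simp at h3
    linarith
  have hpos : 0 < c - (f x).re := by
    have := (Complex.re_le_norm (f x)).trans_lt (H hx).1.2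
    linarith
  have hdx : ‖d x‖ ^ 2 ≤ 0 := nonpos_of_mul_nonpos_right hle' hpos
  refine ⟨min ρ r, lt_min hρ hr, min_le_right _ _, fun z hz => ?_⟩
  have hz' : z ∈ Metric.closedBall (0 : E) ρ :=
    Metric.ball_subset_closedBall (Metric.ball_subset_ball (min_le_left _ _) hz)
  have h4 : ‖d z‖ ^ 2 ≤ 0 := (hmax hz').trans hdx
  exact norm_eq_zero.1 (pow_eq_zero_iff two_ne_zero |>.1 (h4.antisymm (sq_nonneg _)))

theorem sum_ofReal_mul_apply_single {n : ℕ} (L : EuclideanSpace ℝ (Fin n) →L[ℝ] ℂ)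
    (v : EuclideanSpace ℝ (Fin n)) :
    ∑ i, ((v i : ℝ) : ℂ) * L (EuclideanSpace.single i 1) = L v := by
  conv_rhs => rw [← (EuclideanSpace.basisFun (Fin n) ℝ).sum_repr v]
  simp

/-- Solvability and local uniqueness of the `j`-th transport equation of the WKB
construction near the diagonal: for `b` smooth vanishing to second order at `0`,
`f` smooth with `f(0)=0`, `g` smooth and `j ≥ 1`, there is a smooth local solution of
`Σᵢ (zᵢ + bᵢ(z)) ∂a/∂zᵢ + j·a = f·a + g`; any two solutions agree near `0`, and
necessarily `a(0) = g(0)/j`. -/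
theorem stmt4 (n : ℕ) (hn : 1 ≤ n) (Ω : Set (EuclideanSpace ℝ (Fin n)))
    (hΩ : IsOpen Ω) (h0 : (0 : EuclideanSpace ℝ (Fin n)) ∈ Ω)
    (b : EuclideanSpace ℝ (Fin n) → EuclideanSpace ℝ (Fin n))
    (hb : ContDiffOn ℝ (⊤ : ℕ∞) b Ω) (hb0 : b 0 = 0) (hDb : fderiv ℝ b 0 = 0)
    (f : EuclideanSpace ℝ (Fin n) → ℂ) (hf : ContDiffOn ℝ (⊤ : ℕ∞) f Ω) (hf0 : f 0 = 0)
    (g : EuclideanSpace ℝ (Fin n) → ℂ) (hg : ContDiffOn ℝ (⊤ : ℕ∞) g Ω)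
    (j : ℕ) (hj : 1 ≤ j) :
    (∃ r > (0 : ℝ), Metric.ball 0 r ⊆ Ω ∧
      ∃ a : EuclideanSpace ℝ (Fin n) → ℂ,
        ContDiffOn ℝ (⊤ : ℕ∞) a (Metric.ball 0 r) ∧
        ∀ z ∈ Metric.ball (0 : EuclideanSpace ℝ (Fin n)) r,
          (∑ i : Fin n, ((z i + b z i : ℝ) : ℂ) * fderiv ℝ a z (EuclideanSpace.single i 1))
              + (j : ℂ) * a z
            = f z * a z + g z) ∧
    (∀ r > (0 : ℝ), Metric.ball (0 : EuclideanSpace ℝ (Fin n)) r ⊆ Ω →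
      ∀ a₁ a₂ : EuclideanSpace ℝ (Fin n) → ℂ,
        ContDiffOn ℝ (⊤ : ℕ∞) a₁ (Metric.ball 0 r) → ContDiffOn ℝ (⊤ : ℕ∞) a₂ (Metric.ball 0 r) →
        (∀ z ∈ Metric.ball (0 : EuclideanSpace ℝ (Fin n)) r,
          (∑ i : Fin n, ((z i + b z i : ℝ) : ℂ) * fderiv ℝ a₁ z (EuclideanSpace.single i 1))
              + (j : ℂ) * a₁ z
            = f z * a₁ z + g z) →
        (∀ z ∈ Metric.ball (0 : EuclideanSpace ℝ (Fin n)) r,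
          (∑ i : Fin n, ((z i + b z i : ℝ) : ℂ) * fderiv ℝ a₂ z (EuclideanSpace.single i 1))
              + (j : ℂ) * a₂ z
            = f z * a₂ z + g z) →
        (a₁ 0 = g 0 / j ∧
          ∃ r' > (0 : ℝ), r' ≤ r ∧
            ∀ z ∈ Metric.ball (0 : EuclideanSpace ℝ (Fin n)) r', a₁ z = a₂ z)) := by
  have hΩ0 := hΩ.mem_nhds h0
  have hsum : ∀ (a : EuclideanSpace ℝ (Fin n) → ℂ) (z : EuclideanSpace ℝ (Fin n)),
      ∑ i : Fin n, ((z i + b z i : ℝ) : ℂ) * fderiv ℝ a z (EuclideanSpace.single i 1)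
        = fderiv ℝ a z (z + b z) := fun a z => sum_ofReal_mul_apply_single _ (z + b z)
  simp only [hsum]
  refine ⟨?_, fun r hr hrΩ a₁ a₂ h₁ h₂ e₁ e₂ => ⟨?_, ?_⟩⟩
  · obtain ⟨k, rfl⟩ := Nat.exists_eq_add_of_le' hj
    obtain ⟨b', hb', hbb⟩ := hb.exists_contDiff_eventuallyEq hΩ h0
    obtain ⟨f', hf', hff⟩ := hf.exists_contDiff_eventuallyEq hΩ h0
    obtain ⟨g', hg', hgg⟩ := hg.exists_contDiff_eventuallyEq hΩ h0
    obtain ⟨r, hr, a, ha, heq⟩ := exists_transport_solution hb' hf' hg'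
      (hbb.eq_of_nhds.trans hb0) (hbb.fderiv_eq.trans hDb) (hff.eq_of_nhds.trans hf0) k
    obtain ⟨ρ, hρ, H⟩ := Metric.mem_nhds_iff.1 (Filter.inter_mem hΩ0
      (Filter.inter_mem (Metric.ball_mem_nhds _ hr) ((hbb.and hff).and hgg)))
    refine ⟨ρ, hρ, fun z hz => (H hz).1, a, ha.mono fun z hz => (H hz).2.1, fun z hz => ?_⟩
    obtain ⟨-, hzr, ⟨hzb, hzf⟩, hzg⟩ := H hz
    rw [← hzb, ← hzf, ← hzg]
    exact heq z hzr
  · have h := e₁ 0 (Metric.mem_ball_self hr)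
    have hj' : (j : ℂ) ≠ 0 := Nat.cast_ne_zero.2 (by omega)
    rw [hb0, hf0, add_zero, map_zero, zero_add, zero_mul, zero_add] at h
    rw [eq_div_iff hj', mul_comm, h]
  · have hbd : HasFDerivAt b (0 : EuclideanSpace ℝ (Fin n) →L[ℝ] _) 0 := by
      rw [← hDb]
      exact ((hb.contDiffAt hΩ0).differentiableAt (by simp)).hasFDerivAt
    have d₁ := h₁.differentiableOn (by simp)
    have d₂ := h₂.differentiableOn (by simp)
    obtain ⟨r', hr', hr'r, H⟩ := eventually_eq_zero_of_transport (c := j) hr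
      (Nat.cast_pos.2 hj) hbd hb0 (hf.contDiffAt hΩ0).continuousAt hf0 (d₁.sub d₂) fun z hz => by
        have hz' := Metric.isOpen_ball.mem_nhds hz
        rw [fderiv_sub (d₁.differentiableAt hz') (d₂.differentiableAt hz')]
        simp only [sub_apply, Pi.sub_apply, Complex.ofReal_natCast]
        linear_combination e₁ z hz - e₂ z hz
    exact ⟨r', hr', hr'r, fun z hz => sub_eq_zero.1 (H z hz)⟩
end

section
/- Assume H is as in the rescaled bicharacteristic system, with H smooth (C^∞), and suppose there exist ε, c, C > 0 such that for all x ∈ [0,ε), y ∈ ℝ^{n−1} and μ ∈ ℝ^{n−1}: c‖μ‖² ≤ ⟨H(x,y)μ, μ⟩ ≤ C‖μ‖², and all first and second order partial derivatives of H are bounded in norm by C on [0,ε) × ℝ^{n−1}. Let (x, y, λ, μ, ξ) be a C¹ solution of the system on [0,∞) with x(t) > 0 for all t ≥ 0 and inf_{t≥0} x(t) = 0. Then the limits lim_{t→∞} y(t) ∈ ℝ^{n−1}, lim_{t→∞} (λ(t)+1)/x(t) ∈ ℝ, lim_{t→∞} μ(t)/x(t) ∈ ℝ^{n−1}, and lim_{t→∞}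 ξ(t)/x(t) ∈ ℝ^m all exist. -/
open Filter Set

noncomputable section

/-- Apply a matrix `A : Fin d → Fin d → ℝ` to a vector. -/
def appF {d : ℕ} (A : Fin d → Fin d → ℝ) (v : Fin d → ℝ) : Fin d → ℝ :=
  fun i => ∑ j, A i j * v j

/-- Euclidean dot product on `Fin d → ℝ`. -/
def dotF {d : ℕ} (v w : Fin d → ℝ) : ℝ := ∑ i, v i * w i

/-- The partial derivative `∂ₓH`. -/
def Hx' {d : ℕ} (H : ℝ → (Fin d → ℝ) → (Fin d → Fin d → ℝ)) (x : ℝ) (y : Fin d → ℝ) :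
    Fin d → Fin d → ℝ :=
  fderiv ℝ (fun p : ℝ × (Fin d → ℝ) => H p.1 p.2) (x, y) (1, 0)

/-- The partial derivative `∂_{yᵢ}H`. -/
def Hy' {d : ℕ} (H : ℝ → (Fin d → ℝ) → (Fin d → Fin d → ℝ)) (i : Fin d) (x : ℝ)
    (y : Fin d → ℝ) : Fin d → Fin d → ℝ :=
  fderiv ℝ (fun p : ℝ × (Fin d → ℝ) => H p.1 p.2) (x, y) (0, Pi.single i 1)

/-- `(x, y, λ, μ, ξ)` is a solution of the rescaled bicharacteristic system for `H`
on the set `I`:  `x' = λx`, `y' = Hμ`, `λ' = λ + λ² − ⟨Hμ,μ⟩ − (x/2)⟨∂ₓH μ,μ⟩`,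
`μᵢ' = (1+2λ)μᵢ − (1/2)⟨∂_{yᵢ}H μ,μ⟩`, `ξ' = (1+2λ)ξ`. -/
def IsBicharSol {d m : ℕ} (H : ℝ → (Fin d → ℝ) → (Fin d → Fin d → ℝ))
    (x lam : ℝ → ℝ) (y μ : ℝ → Fin d → ℝ) (ξ : ℝ → Fin m → ℝ) (I : Set ℝ) : Prop :=
  ∀ t ∈ I,
    HasDerivAt x (lam t * x t) t ∧
    HasDerivAt y (appF (H (x t) (y t)) (μ t)) t ∧
    HasDerivAt lam (lam t + (lam t) ^ 2 - dotF (appF (H (x t) (y t)) (μ t)) (μ t)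
      - x t / 2 * dotF (appF (Hx' H (x t) (y t)) (μ t)) (μ t)) t ∧
    (∀ i, HasDerivAt (fun s => μ s i)
      ((1 + 2 * lam t) * μ t i
        - 1 / 2 * dotF (appF (Hy' H i (x t) (y t)) (μ t)) (μ t)) t) ∧
    HasDerivAt ξ ((1 + 2 * lam t) • ξ t) t

end

theorem le_of_hasDerivAt_nonpos {f f' : ℝ → ℝ} {a b : ℝ} (hab : a ≤ b)
    (hf : ∀ t ∈ Icc a b, HasDerivAt f (f' t) t) (hf' : ∀ t ∈ Icc a b, f' t ≤ 0) :
    f b ≤ f a :=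
  antitoneOn_of_hasDerivWithinAt_nonpos (f' := f') (convex_Icc a b)
    (fun t ht => (hf t ht).continuousAt.continuousWithinAt)
    (fun t ht => (hf t (interior_subset ht)).hasDerivWithinAt)
    (fun t ht => hf' t (interior_subset ht))
    (left_mem_Icc.2 hab) (right_mem_Icc.2 hab) hab

theorem exists_tendsto_of_abs_deriv_le_exp {f f' : ℝ → ℝ} {T K k : ℝ} (hk : 0 < k)
    (hf : ∀ t, T ≤ t → HasDerivAt f (f' t) t)
    (hf' : ∀ t, T ≤ t → |f' t| ≤ K * Real.exp (-k * t)) :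
    ∃ L, Tendsto f atTop (nhds L) := by
  refine ⟨_, MeasureTheory.tendsto_limUnder_of_hasDerivAt_of_integrableOn_Ioi (a := T) (f' := f')
    (fun t ht => hf t (le_of_lt ht)) ?_⟩
  refine MeasureTheory.Integrable.mono' ((exp_neg_integrableOn_Ioi T hk).const_mul K) ?_ ?_
  · refine (stronglyMeasurable_deriv f).aestronglyMeasurable.congr ?_
    filter_upwards [MeasureTheory.ae_restrict_mem measurableSet_Ioi] with t ht
    exact (hf t (le_of_lt ht)).deriv
  · filter_upwards [MeasureTheory.ae_restrict_mem measurableSet_Ioi] with t ht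
    exact hf' t (le_of_lt ht)

theorem hasDerivAt_exp_const_mul (k t : ℝ) :
    HasDerivAt (fun s => Real.exp (k * s)) (k * Real.exp (k * t)) t := by
  simpa [mul_comm] using ((hasDerivAt_id t).const_mul k).exp

theorem exists_bound_of_abs_deriv_le_exp_mul_norm {d : ℕ} {f g : ℝ → Fin d → ℝ} {T K k : ℝ}
    (hk : 0 < k) (hf : ∀ t, T ≤ t → ∀ i, HasDerivAt (fun s => f s i) (g t i) t)
    (hg : ∀ t, T ≤ t → ∀ i, |g t i| ≤ K * Real.exp (-k * t) * ‖f t‖) :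
    ∃ B, ∀ t, T ≤ t → ‖f t‖ ≤ B := by
  set N : ℝ → ℝ := fun t => ∑ i, f t i ^ 2 with hN
  have hN' : ∀ t, T ≤ t → HasDerivAt N (∑ i, 2 * f t i * g t i) t := by
    intro t ht
    refine HasDerivAt.fun_sum fun i _ => ?_
    simpa using (hf t ht i).fun_pow 2
  have hNf : ∀ t, ‖f t‖ ^ 2 ≤ N t := by
    intro t
    have h0 : 0 ≤ N t := Finset.sum_nonneg fun i _ => sq_nonneg _
    have : ‖f t‖ ≤ √(N t) := by
      refine (pi_norm_le_iff_of_nonneg (Real.sqrt_nonneg _)).2 fun i => ?_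
      refine Real.abs_le_sqrt ?_
      exact Finset.single_le_sum (f := fun i => f t i ^ 2) (fun i _ => sq_nonneg _)
        (Finset.mem_univ i)
    calc ‖f t‖ ^ 2 ≤ √(N t) ^ 2 := by gcongr
      _ = N t := Real.sq_sqrt h0
  set D : ℝ := 2 * d * |K| / k with hD
  have hD0 : 0 ≤ D := by positivity
  have hDk : D * k = 2 * d * |K| := by rw [hD]; field_simp
  set G : ℝ → ℝ := fun t => N t * Real.exp (D * Real.exp (-k * t)) with hG
  have hmono : ∀ t, T ≤ t → G t ≤ G T := by
    intro t ht
    refine le_of_hasDerivAt_nonpos ht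
      (fun s hs => (hN' s hs.1).mul (((hasDerivAt_exp_const_mul (-k) s).const_mul D).exp)) ?_
    intro s hs
    have hsum : ∑ i, 2 * f s i * g s i ≤ D * k * Real.exp (-k * s) * N s := by
      have h1 : ∀ i ∈ Finset.univ, 2 * f s i * g s i ≤ 2 * |K| * Real.exp (-k * s) * N s := by
        intro i _
        have h2 : |f s i| ≤ ‖f s‖ := norm_le_pi_norm (f s) i
        calc 2 * f s i * g s i ≤ |2 * f s i * g s i| := le_abs_self _
          _ = 2 * (|f s i| * |g s i|) := by rw [abs_mul, abs_mul, abs_two]; ring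
          _ ≤ 2 * (‖f s‖ * (|K| * Real.exp (-k * s) * ‖f s‖)) := by
            gcongr
            refine (hg s hs.1 i).trans ?_
            gcongr
            exact le_abs_self K
          _ = 2 * |K| * Real.exp (-k * s) * ‖f s‖ ^ 2 := by ring
          _ ≤ _ := by gcongr; exact hNf s
      refine (Finset.sum_le_card_nsmul _ _ _ h1).trans (le_of_eq ?_)
      rw [hDk]; simp; ring
    have hE := Real.exp_pos (D * Real.exp (-k * s))
    nlinarith
  refine ⟨√(G T), fun t ht => Real.le_sqrt_of_sq_le ?_⟩
  refine ((hNf t).trans ?_).trans (hmono t ht)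
  exact le_mul_of_one_le_right (Finset.sum_nonneg fun i _ => sq_nonneg _)
    (Real.one_le_exp (by positivity))

theorem exists_tendsto_of_abs_deriv_le_exp_mul_norm {d : ℕ} {f g : ℝ → Fin d → ℝ} {T K k : ℝ}
    (hk : 0 < k) (hf : ∀ t, T ≤ t → ∀ i, HasDerivAt (fun s => f s i) (g t i) t)
    (hg : ∀ t, T ≤ t → ∀ i, |g t i| ≤ K * Real.exp (-k * t) * ‖f t‖) :
    ∃ L, Tendsto f atTop (nhds L) := by
  obtain ⟨B, hB⟩ := exists_bound_of_abs_deriv_le_exp_mul_norm hk hf hg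
  have : ∀ i, ∃ L, Tendsto (fun t => f t i) atTop (nhds L) := fun i =>
    exists_tendsto_of_abs_deriv_le_exp (K := |K| * B) hk (fun t ht => hf t ht i) fun t ht => by
      refine (hg t ht i).trans ?_
      calc K * Real.exp (-k * t) * ‖f t‖ ≤ |K| * Real.exp (-k * t) * B := by
            gcongr
            exacts [le_abs_self K, hB t ht]
        _ = _ := by ring
  choose L hL using this
  exact ⟨L, tendsto_pi_nhds.2 hL⟩

/-- Scalar part of the flow: with `e² = λ² + ⟨Hμ,μ⟩`, an incoming ray converges exponentially
to `λ = -1`, `⟨Hμ,μ⟩ = 0`. -/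
theorem exp_decay_of_incoming {e lam F : ℝ → ℝ} {T : ℝ} (hT : 0 ≤ T)
    (he : ∀ t, T ≤ t → 0 < e t)
    (he' : ∀ t, T ≤ t → HasDerivAt e ((1 + lam t) * e t) t)
    (hlam' : ∀ t, T ≤ t → HasDerivAt lam (lam t + lam t ^ 2 - F t) t)
    (hF : ∀ t, T ≤ t → (e t ^ 2 - lam t ^ 2) / 2 ≤ F t)
    (hle : ∀ t, T ≤ t → 0 ≤ e t ^ 2 - lam t ^ 2)
    (hlam : ∀ t, T ≤ t → lam t ≤ 0) :
    ∃ k > 0, ∃ K > 0, ∃ S ≥ T, ∀ t, S ≤ t →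
      |1 + lam t| ≤ K * Real.exp (-k * t) ∧ e t ^ 2 - lam t ^ 2 ≤ K * Real.exp (-k * t) := by
  set p : ℝ → ℝ := fun t => (e t)⁻¹ - 1 with hp
  set u : ℝ → ℝ := fun t => 1 + lam t / e t with hu
  have hu0 : ∀ t, T ≤ t → 0 ≤ u t := by
    intro t ht
    have h1 : -e t ≤ lam t := by nlinarith [he t ht, hle t ht, hlam t ht]
    have : -1 ≤ lam t / e t := by rw [le_div_iff₀ (he t ht)]; linarith
    simp only [hu]; linarith
  have hu1 : ∀ t, T ≤ t → u t ≤ 1 := by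
    intro t ht
    have := div_nonpos_of_nonpos_of_nonneg (hlam t ht) (he t ht).le
    simp only [hu]; linarith
  have hQ : ∀ t, T ≤ t → e t ^ 2 - lam t ^ 2 = e t ^ 2 * (u t * (2 - u t)) := by
    intro t ht
    have := (he t ht).ne'
    simp only [hu]; field_simp; ring
  have hp' : ∀ t, T ≤ t → HasDerivAt p (-p t - u t) t := by
    intro t ht
    have := (he t ht).ne'
    refine (((he' t ht).inv this).sub_const 1).congr_deriv ?_
    simp only [hp, hu]; field_simp; ring
  have hu' : ∀ t, T ≤ t → HasDerivAt u (-(F t / e t)) t := by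
    intro t ht
    have := (he t ht).ne'
    refine (((hlam' t ht).div (he' t ht) this).const_add 1).congr_deriv ?_
    field_simp; ring
  have hexp : ∀ t, HasDerivAt Real.exp (Real.exp t) t := Real.hasDerivAt_exp
  -- the reciprocal of `e` stays bounded
  have hq : ∀ t, T ≤ t → p t * Real.exp t ≤ p T * Real.exp T := by
    intro t ht
    refine le_of_hasDerivAt_nonpos ht (fun s hs => (hp' s hs.1).mul (hexp s)) fun s hs => ?_
    have := mul_nonneg (hu0 s hs.1) (Real.exp_pos s).le
    linarith
  set q : ℝ := |p T * Real.exp T| with hqdef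
  have hpq : ∀ t, T ≤ t → p t ≤ q * Real.exp (-t) := by
    intro t ht
    rw [Real.exp_neg, ← div_eq_mul_inv, le_div_iff₀ (Real.exp_pos t)]
    exact (hq t ht).trans (le_abs_self _)
  have hq0 : 0 ≤ q := abs_nonneg _
  set k : ℝ := (2 * (1 + q))⁻¹ with hk
  have hk0 : 0 < k := by positivity
  have hk1 : k ≤ 1 / 2 := by
    rw [hk, one_div]; gcongr; linarith
  have hek : ∀ t, T ≤ t → 2 * k ≤ e t := by
    intro t ht
    have h1 : Real.exp (-t) ≤ 1 := Real.exp_le_one_iff.2 (by linarith)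
    have h2 : (e t)⁻¹ ≤ 1 + q := by
      have := hpq t ht
      simp only [hp] at this
      nlinarith
    have h3 : 2 * k = (1 + q)⁻¹ := by rw [hk]; field_simp
    rw [h3]
    exact inv_le_of_inv_le₀ (he t ht) h2
  have hFu : ∀ t, T ≤ t → k * u t ≤ F t / e t := by
    intro t ht
    rw [le_div_iff₀ (he t ht)]
    refine le_trans ?_ (hF t ht)
    rw [hQ t ht]
    have h1 : 0 ≤ e t * u t := mul_nonneg (he t ht).le (hu0 t ht)
    have h2 := hek t ht
    have h3 := hu1 t ht
    have h4 : k * (e t * u t) ≤ e t / 2 * (e t * u t) :=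
      mul_le_mul_of_nonneg_right (by linarith) h1
    have h5 : 0 ≤ (e t) ^ 2 * u t * (1 - u t) :=
      mul_nonneg (mul_nonneg (sq_nonneg _) (hu0 t ht)) (by linarith)
    nlinarith
  set U : ℝ := u T * Real.exp (k * T) with hU
  have hU0 : 0 ≤ U := mul_nonneg (hu0 T le_rfl) (Real.exp_pos _).le
  have huU : ∀ t, T ≤ t → u t ≤ U * Real.exp (-k * t) := by
    intro t ht
    rw [neg_mul, Real.exp_neg, ← div_eq_mul_inv, le_div_iff₀ (Real.exp_pos _)]
    refine le_of_hasDerivAt_nonpos (f := fun s => u s * Real.exp (k * s)) ht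
      (fun s hs => (hu' s hs.1).mul (hasDerivAt_exp_const_mul k s)) fun s hs => ?_
    have := hFu s hs.1
    nlinarith [Real.exp_pos (k * s)]
  -- `e` converges exponentially to `1`
  have hpl : ∀ t, T ≤ t → -(p t * Real.exp t) - 2 * U * Real.exp ((1 - k) * t) ≤ q := by
    intro t ht
    have h := le_of_hasDerivAt_nonpos
      (f := fun s => -(p s * Real.exp s) - 2 * U * Real.exp ((1 - k) * s)) ht
      (fun s hs => ((hp' s hs.1).mul (hexp s)).neg.sub
        ((hasDerivAt_exp_const_mul (1 - k) s).const_mul (2 * U))) fun s hs => by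
        have h1 := mul_le_mul_of_nonneg_right (huU s hs.1) (Real.exp_pos s).le
        have h2 : Real.exp ((1 - k) * s) = Real.exp (-k * s) * Real.exp s := by
          rw [← Real.exp_add]; ring_nf
        rw [h2]
        have h3 : 0 ≤ U * (Real.exp (-k * s) * Real.exp s) := by positivity
        nlinarith
    refine h.trans ?_
    have h4 : 0 ≤ 2 * U * Real.exp ((1 - k) * T) := by positivity
    have h5 := neg_abs_le (p T * Real.exp T)
    linarith
  have hpabs : ∀ t, T ≤ t → |p t| ≤ (q + 2 * U) * Real.exp (-k * t) := by
    intro t ht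
    have h1 : Real.exp (-t) ≤ Real.exp (-k * t) := by
      apply Real.exp_le_exp.2; nlinarith
    have h2 := mul_le_mul_of_nonneg_left h1 hq0
    have h3 : 0 ≤ U * Real.exp (-k * t) := by positivity
    have h4 : Real.exp ((1 - k) * t) = Real.exp (-k * t) * Real.exp t := by
      rw [← Real.exp_add]; ring_nf
    have h5 : -p t - 2 * U * Real.exp (-k * t) ≤ q * Real.exp (-t) := by
      rw [Real.exp_neg, ← div_eq_mul_inv, le_div_iff₀ (Real.exp_pos t)]
      have := hpl t ht
      rw [h4] at this
      linarith
    rw [abs_le]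
    constructor
    · linarith
    · linarith [hpq t ht]
  have hlim : Tendsto (fun t => (q + 2 * U) * Real.exp (-k * t)) atTop (nhds 0) := by
    have : Tendsto (fun t => -k * t) atTop atBot :=
      tendsto_id.const_mul_atTop_of_neg (by linarith)
    simpa using (Real.tendsto_exp_atBot.comp this).const_mul (q + 2 * U)
  obtain ⟨S, hS⟩ := eventually_atTop.1 (hlim.eventually_le_const (show (0 : ℝ) < 1 / 2 by norm_num))
  refine ⟨k, hk0, 2 * (q + 3 * U) + 8 * U + 1, by positivity, max S T, le_max_right _ _,
    fun t ht => ?_⟩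
  have htT := (le_max_right S T).trans ht
  have hpt := hpabs t htT
  have hph := abs_le.1 (hpt.trans (hS t ((le_max_left S T).trans ht)))
  have hut := huU t htT
  have hu0t := hu0 t htT
  have het := he t htT
  have he2 : e t ≤ 2 := by
    have : (2 : ℝ)⁻¹ ≤ (e t)⁻¹ := by
      have := hph.1; simp only [hp] at this; norm_num; linarith
    exact (inv_le_inv₀ (by norm_num) het).1 this
  have hX := Real.exp_pos (-k * t)
  have hUX := mul_nonneg hU0 hX.le
  have hqX := mul_nonneg hq0 hX.le
  constructor
  · have h1 : 1 + lam t = e t * (u t + p t) := by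
      simp only [hu, hp]; field_simp; ring
    rw [h1, abs_mul, abs_of_pos het]
    have h2 : |u t + p t| ≤ u t + |p t| := by
      simpa [abs_of_nonneg hu0t] using abs_add_le (u t) (p t)
    have h3 : e t * |u t + p t| ≤ 2 * (u t + |p t|) :=
      mul_le_mul he2 h2 (abs_nonneg _) (by norm_num)
    nlinarith
  · rw [hQ t htT]
    have h1 : e t ^ 2 ≤ 4 := by nlinarith
    have h2 : u t * (2 - u t) ≤ 2 * u t := by nlinarith
    have h3 : e t ^ 2 * (u t * (2 - u t)) ≤ 4 * (2 * u t) :=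
      mul_le_mul h1 h2 (mul_nonneg hu0t (by linarith [hu1 t htT])) (by norm_num)
    nlinarith

section LinearAlgebra

variable {d : ℕ}

theorem abs_dotF_appF_le (A : Fin d → Fin d → ℝ) (v : Fin d → ℝ) :
    |dotF (appF A v) v| ≤ d ^ 2 * ‖A‖ * ‖v‖ ^ 2 := by
  have h : ∀ i j, |A i j * v j * v i| ≤ ‖A‖ * ‖v‖ ^ 2 := by
    intro i j
    rw [abs_mul, abs_mul, mul_assoc, sq]
    have h1 : |A i j| ≤ ‖A‖ := (norm_le_pi_norm (A i) j).trans (norm_le_pi_norm A i)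
    have h2 : ∀ l, |v l| ≤ ‖v‖ := fun l => norm_le_pi_norm v l
    gcongr <;> apply h2
  simp only [dotF, appF, Finset.sum_mul]
  calc |∑ i, ∑ j, A i j * v j * v i| ≤ ∑ i, |∑ j, A i j * v j * v i| :=
        Finset.abs_sum_le_sum_abs _ _
    _ ≤ ∑ i : Fin d, ∑ j : Fin d, ‖A‖ * ‖v‖ ^ 2 := by
        refine Finset.sum_le_sum fun i _ => (Finset.abs_sum_le_sum_abs _ _).trans ?_
        exact Finset.sum_le_sum fun j _ => h i j
    _ = _ := by simp; ring

theorem sq_norm_le_dotF (v : Fin d → ℝ) : ‖v‖ ^ 2 ≤ dotF v v := by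
  have h0 : 0 ≤ dotF v v := Finset.sum_nonneg fun i _ => mul_self_nonneg _
  refine (Real.le_sqrt (norm_nonneg _) h0).1 ?_
  refine (pi_norm_le_iff_of_nonneg (Real.sqrt_nonneg _)).2 fun i => Real.abs_le_sqrt ?_
  rw [sq]
  exact Finset.single_le_sum (f := fun i => v i * v i) (fun i _ => mul_self_nonneg _)
    (Finset.mem_univ i)

theorem dotF_appF_comm {A : Fin d → Fin d → ℝ} (hA : ∀ i j, A i j = A j i) (v w : Fin d → ℝ) :
    dotF (appF A v) w = dotF (appF A w) v := by
  simp only [dotF, appF, Finset.sum_mul]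
  rw [Finset.sum_comm]
  refine Finset.sum_congr rfl fun i _ => Finset.sum_congr rfl fun j _ => ?_
  rw [hA j i]; ring

theorem appF_add (A : Fin d → Fin d → ℝ) (v w : Fin d → ℝ) :
    appF A (v + w) = appF A v + appF A w := by
  funext i; simp [appF, mul_add, Finset.sum_add_distrib]

theorem appF_smul (A : Fin d → Fin d → ℝ) (r : ℝ) (v : Fin d → ℝ) :
    appF A (r • v) = r • appF A v := by
  funext i
  simp only [appF, Pi.smul_apply, smul_eq_mul, Finset.mul_sum]
  exact Finset.sum_congr rfl fun j _ => by ring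

theorem dotF_add_left (u v w : Fin d → ℝ) : dotF (u + v) w = dotF u w + dotF v w := by
  simp [dotF, add_mul, Finset.sum_add_distrib]

theorem dotF_add_right (u v w : Fin d → ℝ) : dotF u (v + w) = dotF u v + dotF u w := by
  simp [dotF, mul_add, Finset.sum_add_distrib]

theorem dotF_smul_left (r : ℝ) (v w : Fin d → ℝ) : dotF (r • v) w = r * dotF v w := by
  simp only [dotF, Pi.smul_apply, smul_eq_mul, Finset.mul_sum]
  exact Finset.sum_congr rfl fun j _ => by ring

theorem dotF_smul_right (r : ℝ) (v w : Fin d → ℝ) : dotF v (r • w) = r * dotF v w := by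
  simp only [dotF, Pi.smul_apply, smul_eq_mul, Finset.mul_sum]
  exact Finset.sum_congr rfl fun j _ => by ring

theorem dotF_appF_single (A : Fin d → Fin d → ℝ) (i j : Fin d) :
    dotF (appF A (Pi.single j 1)) (Pi.single i 1) = A i j := by
  simp [dotF, appF, Pi.single_apply]

theorem abs_entry_le_of_dotF_appF_le {A : Fin d → Fin d → ℝ} (hA : ∀ i j, A i j = A j i) {C : ℝ}
    (h0 : ∀ v, 0 ≤ dotF (appF A v) v) (h1 : ∀ v, dotF (appF A v) v ≤ C * dotF v v)
    (i j : Fin d) : |A i j| ≤ C := by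
  have hdiag : ∀ l, A l l ≤ C := fun l => by
    have := h1 (Pi.single l 1)
    rw [dotF_appF_single] at this
    simpa [dotF, Pi.single_apply] using this
  have key : ∀ r : ℝ, 0 ≤ A i i + 2 * r * A i j + r ^ 2 * A j j := by
    intro r
    have := h0 (Pi.single i 1 + r • Pi.single j 1)
    simp only [appF_add, appF_smul, dotF_add_left, dotF_add_right, dotF_smul_left,
      dotF_smul_right, dotF_appF_single, hA j i] at this
    linarith
  have k1 := key 1
  have k2 := key (-1)
  have hi := hdiag i
  have hj := hdiag j
  rw [abs_le]
  constructor <;> linarith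

theorem norm_appF_le {A : Fin d → Fin d → ℝ} {C : ℝ} (hC : 0 ≤ C) (hA : ∀ i j, |A i j| ≤ C)
    (v : Fin d → ℝ) : ‖appF A v‖ ≤ d * C * ‖v‖ := by
  refine (pi_norm_le_iff_of_nonneg (by positivity)).2 fun i => ?_
  calc ‖appF A v i‖ ≤ ∑ j, ‖A i j * v j‖ := norm_sum_le _ _
    _ ≤ ∑ _j : Fin d, C * ‖v‖ := by
        refine Finset.sum_le_sum fun j _ => ?_
        rw [norm_mul]
        have h1 : ‖A i j‖ ≤ C := hA i j
        have h2 := norm_le_pi_norm v j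
        gcongr
    _ = _ := by simp; ring

theorem hasDerivAt_dotF_appF {A : ℝ → Fin d → Fin d → ℝ} {v : ℝ → Fin d → ℝ}
    {A' : Fin d → Fin d → ℝ} {v' : Fin d → ℝ} {t : ℝ} (hsymm : ∀ i j, A t i j = A t j i)
    (hA : HasDerivAt A A' t) (hv : HasDerivAt v v' t) :
    HasDerivAt (fun s => dotF (appF (A s) (v s)) (v s))
      (dotF (appF A' (v t)) (v t) + 2 * dotF (appF (A t) (v t)) v') t := by
  have hAij : ∀ i j, HasDerivAt (fun s => A s i j) (A' i j) t := fun i j =>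
    hasDerivAt_pi.1 (hasDerivAt_pi.1 hA i) j
  have hvi : ∀ i, HasDerivAt (fun s => v s i) (v' i) t := hasDerivAt_pi.1 hv
  have h : HasDerivAt (fun s => dotF (appF (A s) (v s)) (v s))
      (∑ i, ((∑ j, (A' i j * v t j + A t i j * v' j)) * v t i
        + (∑ j, A t i j * v t j) * v' i)) t := by
    refine HasDerivAt.fun_sum fun i _ => HasDerivAt.fun_mul ?_ (hvi i)
    exact HasDerivAt.fun_sum fun j _ => (hAij i j).fun_mul (hvi j)
  refine h.congr_deriv ?_
  have h2 : dotF (appF (A t) v') (v t) = dotF (appF (A t) (v t)) v' := dotF_appF_comm hsymm _ _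
  rw [two_mul, ← add_assoc]
  nth_rewrite 1 [← h2]
  simp only [dotF, appF, Finset.sum_add_distrib, add_mul]

end LinearAlgebra

section Bicharacteristic

variable {d m : ℕ} {H : ℝ → (Fin d → ℝ) → (Fin d → Fin d → ℝ)}
  {x lam : ℝ → ℝ} {y μ : ℝ → Fin d → ℝ} {ξ : ℝ → Fin m → ℝ} {I : Set ℝ}

theorem fderiv_uncurry_apply (a b : ℝ) (w v : Fin d → ℝ) :
    fderiv ℝ (fun p : ℝ × (Fin d → ℝ) => H p.1 p.2) (b, w) (a, v)
      = a • Hx' H b w + ∑ i, v i • Hy' H i b w := by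
  have h : ((a, v) : ℝ × (Fin d → ℝ))
      = a • ((1, 0) : ℝ × (Fin d → ℝ)) + ∑ i, v i • ((0, Pi.single i 1) : ℝ × (Fin d → ℝ)) := by
    ext j
    · simp [Prod.fst_sum]
    · simp [Prod.snd_sum, Finset.sum_apply, Pi.single_apply]
  rw [h, map_add, map_smul, map_sum]
  simp only [map_smul]
  rfl

theorem dotF_appF_lincomb (a : ℝ) (w : Fin d → ℝ) (A : Fin d → Fin d → ℝ)
    (B : Fin d → Fin d → Fin d → ℝ) (v : Fin d → ℝ) :
    dotF (appF (a • A + ∑ i, w i • B i) v) v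
      = a * dotF (appF A v) v + ∑ i, w i * dotF (appF (B i) v) v := by
  let Φ : (Fin d → Fin d → ℝ) →ₗ[ℝ] ℝ :=
    { toFun := fun M => dotF (appF M v) v
      map_add' := fun M N => by simp [dotF, appF, add_mul, Finset.sum_add_distrib]
      map_smul' := fun r M => by
        simp [dotF, appF, Finset.mul_sum, Finset.sum_mul, mul_assoc] }
  have := map_add Φ (a • A) (∑ i, w i • B i)
  rw [map_smul, map_sum] at this
  simp only [map_smul] at this
  exact this

/-- Along the flow, `⟨Hμ,μ⟩' = 2(1+2λ)⟨Hμ,μ⟩ + λx⟨∂ₓH μ,μ⟩`. -/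
theorem IsBicharSol.hasDerivAt_dotF
    (hH : Differentiable ℝ (fun p : ℝ × (Fin d → ℝ) => H p.1 p.2))
    (hsymm : ∀ x y, ∀ i j, H x y i j = H x y j i)
    (hsol : IsBicharSol H x lam y μ ξ I) {t : ℝ} (ht : t ∈ I) :
    HasDerivAt (fun s => dotF (appF (H (x s) (y s)) (μ s)) (μ s))
      (2 * (1 + 2 * lam t) * dotF (appF (H (x t) (y t)) (μ t)) (μ t)
        + lam t * x t * dotF (appF (Hx' H (x t) (y t)) (μ t)) (μ t)) t := by
  obtain ⟨hx, hy, -, hμ, -⟩ := hsol t ht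
  have hA : HasDerivAt (fun s => H (x s) (y s))
      (fderiv ℝ (fun p : ℝ × (Fin d → ℝ) => H p.1 p.2) (x t, y t)
        (lam t * x t, appF (H (x t) (y t)) (μ t))) t :=
    HasFDerivAt.comp_hasDerivAt (f := fun s => (x s, y s)) t (hH (x t, y t)).hasFDerivAt
      (hx.prodMk hy)
  refine (hasDerivAt_dotF_appF (hsymm _ _) hA (hasDerivAt_pi.2 hμ)).congr_deriv ?_
  rw [fderiv_uncurry_apply, dotF_appF_lincomb]
  have : dotF (appF (H (x t) (y t)) (μ t)) (fun i => (1 + 2 * lam t) * μ t i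
      - 1 / 2 * dotF (appF (Hy' H i (x t) (y t)) (μ t)) (μ t))
      = (1 + 2 * lam t) * dotF (appF (H (x t) (y t)) (μ t)) (μ t)
        - 1 / 2 * ∑ i, appF (H (x t) (y t)) (μ t) i
          * dotF (appF (Hy' H i (x t) (y t)) (μ t)) (μ t) := by
    simp only [dotF, mul_sub, Finset.sum_sub_distrib, Finset.mul_sum]
    congr 1 <;> refine Finset.sum_congr rfl fun i _ => ?_
    · ring
    · rw [Finset.sum_congr rfl fun j _ => ?_]
      ring
  rw [this]; ring

/-- The energy `λ² + ⟨Hμ,μ⟩` is a constant multiple of `(x eᵗ)²`. -/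
theorem IsBicharSol.exists_energy_eq
    (hH : Differentiable ℝ (fun p : ℝ × (Fin d → ℝ) => H p.1 p.2))
    (hsymm : ∀ x y, ∀ i j, H x y i j = H x y j i)
    (hsol : IsBicharSol H x lam y μ ξ (Ici 0)) (hxpos : ∀ t : ℝ, 0 ≤ t → 0 < x t) :
    ∃ A : ℝ, ∀ t, 0 ≤ t → lam t ^ 2 + dotF (appF (H (x t) (y t)) (μ t)) (μ t)
      = A * (x t * Real.exp t) ^ 2 := by
  set E : ℝ → ℝ := fun t => lam t ^ 2 + dotF (appF (H (x t) (y t)) (μ t)) (μ t) with hE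
  set z : ℝ → ℝ := fun t => x t * Real.exp t with hz
  have hz0 : ∀ t, 0 ≤ t → z t ≠ 0 := fun t ht => (mul_pos (hxpos t ht) (Real.exp_pos t)).ne'
  have hz' : ∀ t, 0 ≤ t → HasDerivAt z ((1 + lam t) * z t) t := fun t ht =>
    ((hsol t ht).1.mul (Real.hasDerivAt_exp t)).congr_deriv (by simp only [hz]; ring)
  have hE' : ∀ t, 0 ≤ t → HasDerivAt E (2 * (1 + lam t) * E t) t := fun t ht =>
    (((hsol t ht).2.2.1.fun_pow 2).add (hsol.hasDerivAt_dotF hH hsymm ht)).congr_deriv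
      (by simp only [hE]; push_cast; ring)
  have hR : ∀ t, 0 ≤ t → HasDerivAt (fun s => E s / z s ^ 2) 0 t := fun t ht =>
    ((hE' t ht).div ((hz' t ht).fun_pow 2) (pow_ne_zero 2 (hz0 t ht))).congr_deriv
      (by have := hz0 t ht; field_simp; push_cast; ring)
  refine ⟨E 0 / z 0 ^ 2, fun t ht => ?_⟩
  have h1 := le_of_hasDerivAt_nonpos ht (fun s hs => hR s hs.1) fun _ _ => le_rfl
  have h2 := le_of_hasDerivAt_nonpos ht (fun s hs => (hR s hs.1).neg) fun _ _ => neg_zero.le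
  have h3 : E t / z t ^ 2 = E 0 / z 0 ^ 2 :=
    le_antisymm h1 (by simpa using h2)
  rw [← h3, div_mul_cancel₀ _ (pow_ne_zero 2 (hz0 t ht))]

end Bicharacteristic

theorem exists_neg_logDeriv_of_sInf_eq_zero {x lam : ℝ → ℝ}
    (hx : ∀ t, 0 ≤ t → HasDerivAt x (lam t * x t) t) (hxpos : ∀ t, 0 ≤ t → 0 < x t)
    (hinf : sInf (x '' Ici 0) = 0) {δ : ℝ} (hδ : 0 < δ) :
    ∃ t, 0 ≤ t ∧ x t < δ ∧ lam t < 0 := by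
  have hsmall : ∀ η > 0, ∃ t, 0 ≤ t ∧ x t < η := by
    intro η hη
    obtain ⟨_, ⟨t, ht, rfl⟩, h⟩ := exists_lt_of_csInf_lt
      (⟨_, mem_image_of_mem x self_mem_Ici⟩ : (x '' Ici 0).Nonempty) (hinf.trans_lt hη)
    exact ⟨t, ht, h⟩
  have hcont : ∀ {s : Set ℝ}, s ⊆ Ici 0 → ContinuousOn x s := fun hs t ht =>
    (hx t (hs ht)).continuousAt.continuousWithinAt
  obtain ⟨a, ha, hxa⟩ := hsmall δ hδ
  obtain ⟨r, hr, hrmin⟩ := isCompact_Icc.exists_isMinOn (nonempty_Icc.2 ha)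
    (hcont (Icc_subset_Ici_self))
  obtain ⟨b, hb, hxb⟩ := hsmall (x r) (hxpos r hr.1)
  have hab : a < b := by
    by_contra! h
    exact (hrmin ⟨hb, h⟩ : x r ≤ x b).not_gt hxb
  have hra : x r ≤ x a := hrmin ⟨ha, le_rfl⟩
  have hcab : ContinuousOn x (Icc a b) := hcont (Icc_subset_Ici_self.trans (Ici_subset_Ici.2 ha))
  obtain ⟨s, ⟨hs, hsmax⟩⟩ :=
    (isCompact_Icc.of_isClosed_subset
      (hcab.preimage_isClosed_of_isClosed isClosed_Icc (isClosed_Ici (a := x a)))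
      inter_subset_left).exists_isGreatest ⟨a, left_mem_Icc.2 hab.le, le_refl (x a)⟩
  have hxs : x a ≤ x s := hs.2
  have hsb : s < b := lt_of_le_of_ne hs.1.2 fun h => by rw [h] at hxs; linarith
  obtain ⟨t, ht, hslope⟩ := exists_hasDerivAt_eq_slope x (fun t => lam t * x t) hsb
    (hcab.mono (Icc_subset_Icc_left hs.1.1))
    fun t ht => hx t (ha.trans (hs.1.1.trans ht.1.le))
  have ht0 : 0 ≤ t := ha.trans (hs.1.1.trans ht.1.le)
  refine ⟨t, ht0, ?_, ?_⟩
  · by_contra! h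
    exact (hsmax ⟨⟨hs.1.1.trans ht.1.le, ht.2.le⟩, hxa.le.trans h⟩).not_gt ht.1
  · have h1 : lam t * x t < 0 := by
      rw [hslope]; exact div_neg_of_neg_of_pos (by linarith) (by linarith)
    exact neg_of_mul_neg_left h1 (hxpos t ht0).le

/-- Below the level `δ` an incoming ray (`λ ≤ 0`) stays incoming and below `δ`. -/
theorem incoming_of_incoming {x lam F : ℝ → ℝ} {T δ : ℝ} (hT : 0 ≤ T)
    (hx : ∀ t, 0 ≤ t → HasDerivAt x (lam t * x t) t) (hxpos : ∀ t, 0 ≤ t → 0 < x t)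
    (hlam : ∀ t, 0 ≤ t → HasDerivAt lam (lam t + lam t ^ 2 - F t) t)
    (hF : ∀ t, 0 ≤ t → x t < δ → 0 ≤ F t) (hxT : x T < δ) (hlamT : lam T ≤ 0) :
    ∀ t, T ≤ t → x t < δ ∧ lam t ≤ 0 := by
  obtain ⟨δ', hδ', hδ'δ⟩ := exists_between hxT
  have hlamle : ∀ b, T ≤ b → (∀ t ∈ Icc T b, x t ≤ δ') → lam b ≤ 0 := by
    intro b hb hxb
    have h := le_of_hasDerivAt_nonpos (f := fun s => lam s / (x s * Real.exp s)) hb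
      (fun s hs => (hlam s (hT.trans hs.1)).div ((hx s (hT.trans hs.1)).mul
        (Real.hasDerivAt_exp s)) (mul_pos (hxpos s (hT.trans hs.1)) (Real.exp_pos s)).ne')
      fun s hs => by
        have h1 := hF s (hT.trans hs.1) ((hxb s hs).trans_lt hδ'δ)
        refine div_nonpos_of_nonpos_of_nonneg ?_ (sq_nonneg _)
        have h2 : 0 ≤ F s * (x s * Real.exp s) :=
          mul_nonneg h1 (mul_pos (hxpos s (hT.trans hs.1)) (Real.exp_pos s)).le
        nlinarith
    have h3 : lam b / (x b * Real.exp b) ≤ 0 := h.trans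
      (div_nonpos_of_nonpos_of_nonneg hlamT
        (mul_pos (hxpos T hT) (Real.exp_pos T)).le)
    by_contra! h4
    exact h3.not_gt (div_pos h4 (mul_pos (hxpos b (hT.trans hb)) (Real.exp_pos b)))
  have hlt : ∀ t, T ≤ t → x t ≤ δ' := by
    intro b hb
    by_contra! hxb
    have hcont : ContinuousOn x (Icc T b) := fun t ht =>
      (hx t (hT.trans ht.1)).continuousAt.continuousWithinAt
    obtain ⟨s, hs, hsmin⟩ :=
      (isCompact_Icc.of_isClosed_subset
        (hcont.preimage_isClosed_of_isClosed isClosed_Icc (isClosed_Ici (a := δ')))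
        inter_subset_left).exists_isLeast ⟨b, right_mem_Icc.2 hb, hxb.le⟩
    have hbelow : ∀ t ∈ Ico T s, x t < δ' := by
      intro t ht
      by_contra! h
      exact (hsmin ⟨⟨ht.1, ht.2.le.trans hs.1.2⟩, h⟩).not_gt ht.2
    have hxs : x s ≤ δ' := by
      by_contra! h
      obtain ⟨r, hr, hxr⟩ := intermediate_value_Icc hs.1.1
        (hcont.mono (Icc_subset_Icc_right hs.1.2)) ⟨hδ'.le, h.le⟩
      have h1 : s ≤ r := hsmin ⟨⟨hr.1, hr.2.trans hs.1.2⟩, hxr.ge⟩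
      rw [le_antisymm h1 hr.2, hxr] at h
      exact lt_irrefl _ h
    have hxle : ∀ t ∈ Icc T s, x t ≤ δ' := fun t ht => by
      rcases ht.2.lt_or_eq with h | h
      · exact (hbelow t ⟨ht.1, h⟩).le
      · exact h ▸ hxs
    have h1 : x s ≤ x T := le_of_hasDerivAt_nonpos hs.1.1 (fun t ht => hx t (hT.trans ht.1))
      fun t ht => mul_nonpos_of_nonpos_of_nonneg
        (hlamle t ht.1 fun r hr => hxle r ⟨hr.1, hr.2.trans ht.2⟩) (hxpos t (hT.trans ht.1)).le
    have h2 : δ' ≤ x s := hs.2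
    linarith
  exact fun t ht => ⟨(hlt t ht).trans_lt hδ'δ, hlamle t ht fun r hr => hlt r hr.1⟩

section Limits

variable {d m : ℕ} {H : ℝ → (Fin d → ℝ) → (Fin d → Fin d → ℝ)}
  {x lam : ℝ → ℝ} {y μ : ℝ → Fin d → ℝ} {ξ : ℝ → Fin m → ℝ} {ε c C : ℝ}

theorem norm_partials_le {a : ℝ} {w : Fin d → ℝ}
    (h : ‖iteratedFDeriv ℝ 1 (fun p : ℝ × (Fin d → ℝ) => H p.1 p.2) (a, w)‖ ≤ C) :
    ‖Hx' H a w‖ ≤ C ∧ ∀ i, ‖Hy' H i a w‖ ≤ C := by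
  rw [norm_iteratedFDeriv_one] at h
  have key : ∀ v : ℝ × (Fin d → ℝ), ‖v‖ ≤ 1 →
      ‖fderiv ℝ (fun p : ℝ × (Fin d → ℝ) => H p.1 p.2) (a, w) v‖ ≤ C := fun v hv =>
    (ContinuousLinearMap.le_of_opNorm_le _ h v).trans
      (mul_le_of_le_one_right ((norm_nonneg _).trans h) hv)
  refine ⟨key _ ?_, fun i => key _ ?_⟩
  · simp [Prod.norm_def]
  · simp [Prod.norm_def, Pi.norm_single]

theorem IsBicharSol.exists_exp_decay
    (hH : Differentiable ℝ (fun p : ℝ × (Fin d → ℝ) => H p.1 p.2))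
    (hsymm : ∀ x y, ∀ i j, H x y i j = H x y j i) (hε : 0 < ε) (hc : 0 < c) (hC : 0 < C)
    (hpos : ∀ a ∈ Ico (0 : ℝ) ε, ∀ w v : Fin d → ℝ, c * dotF v v ≤ dotF (appF (H a w) v) v)
    (hder : ∀ a ∈ Ico (0 : ℝ) ε, ∀ w : Fin d → ℝ, ‖Hx' H a w‖ ≤ C)
    (hsol : IsBicharSol H x lam y μ ξ (Ici 0)) (hxpos : ∀ t : ℝ, 0 ≤ t → 0 < x t)
    (hinf : sInf (x '' Ici 0) = 0) :
    ∃ k > 0, ∃ K ≥ 0, ∃ S ≥ 0, ∀ t, S ≤ t → x t < ε ∧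
      |1 + lam t| ≤ K * Real.exp (-k * t) ∧ ‖μ t‖ ≤ K * Real.exp (-k * t) := by
  set Q : ℝ → ℝ := fun t => dotF (appF (H (x t) (y t)) (μ t)) (μ t) with hQ
  set R : ℝ → ℝ := fun t => x t / 2 * dotF (appF (Hx' H (x t) (y t)) (μ t)) (μ t) with hR
  have hQμ : ∀ t, 0 ≤ t → x t < ε → c * ‖μ t‖ ^ 2 ≤ Q t := fun t ht hxt =>
    (mul_le_mul_of_nonneg_left (sq_norm_le_dotF _) hc.le).trans
      (hpos _ ⟨(hxpos t ht).le, hxt⟩ _ _)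
  have hQ0 : ∀ t, 0 ≤ t → x t < ε → 0 ≤ Q t := fun t ht hxt =>
    (by positivity : 0 ≤ c * ‖μ t‖ ^ 2).trans (hQμ t ht hxt)
  set δ : ℝ := min ε (c / (d ^ 2 * C + 1)) with hδ
  have hδ0 : 0 < δ := lt_min hε (by positivity)
  have hRQ : ∀ t, 0 ≤ t → x t < δ → |R t| ≤ Q t / 2 := by
    intro t ht hxt
    have hxε := hxt.trans_le (min_le_left _ _)
    have hx0 := hxpos t ht
    have h1 := (hxt.trans_le (min_le_right _ _)).le
    rw [le_div_iff₀ (by positivity)] at h1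
    have h2 : |R t| ≤ x t / 2 * (d ^ 2 * C * ‖μ t‖ ^ 2) := by
      rw [hR, abs_mul, abs_of_pos (by positivity : 0 < x t / 2)]
      gcongr
      refine (abs_dotF_appF_le _ _).trans ?_
      gcongr
      exact hder _ ⟨hx0.le, hxε⟩ _
    have h3 : x t * (d ^ 2 * C) ≤ c := by linarith
    have h4 := mul_le_mul_of_nonneg_right h3 (sq_nonneg ‖μ t‖)
    have h5 := hQμ t ht hxε
    nlinarith
  have hlam' : ∀ t, 0 ≤ t → HasDerivAt lam (lam t + lam t ^ 2 - (Q t + R t)) t := fun t ht =>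
    (hsol t ht).2.2.1.congr_deriv (by simp only [hQ, hR]; ring)
  have hx' : ∀ t, 0 ≤ t → HasDerivAt x (lam t * x t) t := fun t ht => (hsol t ht).1
  obtain ⟨T, hT, hxT, hlamT⟩ := exists_neg_logDeriv_of_sInf_eq_zero hx' hxpos hinf hδ0
  have hin := incoming_of_incoming hT hx' hxpos hlam'
    (fun t ht hxt => by
      have h1 := abs_le.1 (hRQ t ht hxt)
      have h2 := hQ0 t ht (hxt.trans_le (min_le_left _ _))
      linarith [h1.1]) hxT hlamT.le
  have hxε : ∀ t, T ≤ t → x t < ε := fun t ht => (hin t ht).1.trans_le (min_le_left _ _)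
  obtain ⟨A, hA⟩ := hsol.exists_energy_eq hH hsymm hxpos
  have hA0 : 0 < A := by
    have h1 := hA T hT
    have h2 : 0 < lam T ^ 2 := sq_pos_of_neg hlamT
    have h3 := hQ0 T hT (hxε T le_rfl)
    exact pos_of_mul_pos_left (h1 ▸ add_pos_of_pos_of_nonneg h2 h3) (sq_nonneg _)
  set e : ℝ → ℝ := fun t => √A * (x t * Real.exp t) with he
  have heQ : ∀ t, 0 ≤ t → e t ^ 2 - lam t ^ 2 = Q t := fun t ht => by
    have := hA t ht
    simp only [he, mul_pow √A, Real.sq_sqrt hA0.le, ← this, hQ]; ring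
  obtain ⟨k, hk, K, hK, S, hS, hdecay⟩ := exp_decay_of_incoming (e := e) hT
    (fun t ht => mul_pos (Real.sqrt_pos.2 hA0)
      (mul_pos (hxpos t (hT.trans ht)) (Real.exp_pos t)))
    (fun t ht => (((hx' t (hT.trans ht)).mul (Real.hasDerivAt_exp t)).const_mul √A).congr_deriv
      (by simp only [he]; ring))
    (fun t ht => hlam' t (hT.trans ht))
    (fun t ht => by
      rw [heQ t (hT.trans ht)]
      have := (abs_le.1 (hRQ t (hT.trans ht) (hin t ht).1)).1
      linarith)
    (fun t ht => by
      rw [heQ t (hT.trans ht)]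
      exact hQ0 t (hT.trans ht) (hxε t ht))
    (fun t ht => (hin t ht).2)
  refine ⟨k / 2, by positivity, K + √(K / c), by positivity, S, hT.trans hS, fun t ht => ?_⟩
  have htT := hS.trans ht
  have ht0 := hT.trans htT
  have hsq : Real.exp (-k * t) = Real.exp (-(k / 2) * t) ^ 2 := by
    rw [← Real.exp_nat_mul]; congr 1; push_cast; ring
  have hX0 := Real.exp_pos (-(k / 2) * t)
  have hX1 : Real.exp (-(k / 2) * t) ≤ 1 := Real.exp_le_one_iff.2 (by nlinarith)
  obtain ⟨h1, h2⟩ := hdecay t ht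
  rw [hsq] at h1 h2
  rw [heQ t ht0] at h2
  refine ⟨hxε t htT, h1.trans ?_, ?_⟩
  · have h3 : Real.exp (-(k / 2) * t) ^ 2 ≤ Real.exp (-(k / 2) * t) := by nlinarith
    have h4 := mul_le_mul_of_nonneg_left h3 hK.le
    have h5 := mul_nonneg (Real.sqrt_nonneg (K / c)) hX0.le
    linarith
  · have h3 : ‖μ t‖ ^ 2 ≤ (√(K / c) * Real.exp (-(k / 2) * t)) ^ 2 := by
      rw [mul_pow, Real.sq_sqrt (by positivity), div_mul_eq_mul_div, le_div_iff₀ hc]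
      linarith [hQμ t ht0 (hxε t htT)]
    have h4 := le_of_sq_le_sq h3 (by positivity)
    have h5 := mul_nonneg hK.le hX0.le
    linarith

end Limits

/-- Lemmas 3.3 and 3.6 of the paper, in local coordinates: along every non-trapped ray
of the rescaled bicharacteristic system (for smooth `H`, uniformly positive definite
near the boundary with bounded first and second derivatives), the blow-up coordinates
have limits: `y(t) → y₀`, `(λ(t)+1)/x(t) → Λ`, `μ(t)/x(t) → M`, `ξ(t)/x(t) → Ξ`
as `t → ∞`; these limits are the data of the forward sojourn relation. -/
theorem stmt13 (n m : ℕ) (hn : 2 ≤ n) (hm : 1 ≤ m)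
    (H : ℝ → (Fin (n - 1) → ℝ) → (Fin (n - 1) → Fin (n - 1) → ℝ))
    (hH : ContDiff ℝ (⊤ : ℕ∞) (fun p : ℝ × (Fin (n - 1) → ℝ) => H p.1 p.2))
    (hsymm : ∀ x y, ∀ i j, H x y i j = H x y j i)
    (ε c C : ℝ) (hε : 0 < ε) (hc : 0 < c) (hC : 0 < C)
    (hpos : ∀ x ∈ Set.Ico (0 : ℝ) ε, ∀ y μ : Fin (n - 1) → ℝ,
      c * dotF μ μ ≤ dotF (appF (H x y) μ) μ ∧ dotF (appF (H x y) μ) μ ≤ C * dotF μ μ)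
    (hder : ∀ x ∈ Set.Ico (0 : ℝ) ε, ∀ y : Fin (n - 1) → ℝ,
      ‖iteratedFDeriv ℝ 1 (fun p : ℝ × (Fin (n - 1) → ℝ) => H p.1 p.2) (x, y)‖ ≤ C ∧
      ‖iteratedFDeriv ℝ 2 (fun p : ℝ × (Fin (n - 1) → ℝ) => H p.1 p.2) (x, y)‖ ≤ C)
    (x lam : ℝ → ℝ) (y μ : ℝ → Fin (n - 1) → ℝ) (ξ : ℝ → Fin m → ℝ)
    (hsol : IsBicharSol H x lam y μ ξ (Set.Ici 0))
    (hxpos : ∀ t : ℝ, 0 ≤ t → 0 < x t)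
    (hinf : sInf (x '' Set.Ici 0) = 0) :
    (∃ y0 : Fin (n - 1) → ℝ, Tendsto y atTop (nhds y0)) ∧
    (∃ Λ : ℝ, Tendsto (fun t => (lam t + 1) / x t) atTop (nhds Λ)) ∧
    (∃ M : Fin (n - 1) → ℝ, Tendsto (fun t => fun i => μ t i / x t) atTop (nhds M)) ∧
    (∃ Ξ : Fin m → ℝ, Tendsto (fun t => (x t)⁻¹ • ξ t) atTop (nhds Ξ)) := by
  have hdiff := hH.differentiable (by simp)
  have hpart := fun a ha w => norm_partials_le (hder a ha w).1
  obtain ⟨k, hk, K, hK, S, hS, hdecay⟩ := hsol.exists_exp_decay hdiff hsymm hε hc hC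
    (fun a ha w v => (hpos a ha w v).1) (fun a ha w => (hpart a ha w).1) hxpos hinf
  have h0 : ∀ t, S ≤ t → 0 ≤ t := fun t ht => hS.le.trans ht
  have hx0 : ∀ t, S ≤ t → 0 < x t := fun t ht => hxpos t (h0 t ht)
  have hmem : ∀ t, S ≤ t → x t ∈ Ico 0 ε := fun t ht => ⟨(hx0 t ht).le, (hdecay t ht).1⟩
  have hquot : ∀ t, S ≤ t → ∀ (f : ℝ → ℝ) (f' : ℝ), HasDerivAt f f' t →
      HasDerivAt (fun s => f s / x s) (f' / x t - lam t * (f t / x t)) t := by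
    intro t ht f f' hf
    have := (hx0 t ht).ne'
    exact (hf.div (hsol t (h0 t ht)).1 this).congr_deriv (by field_simp)
  set v : ℝ → Fin (n - 1) → ℝ := fun t i => μ t i / x t with hv
  have hμv : ∀ t, S ≤ t → ‖μ t‖ = x t * ‖v t‖ := by
    intro t ht
    have h1 : μ t = x t • v t := by
      funext i
      simp only [hv, Pi.smul_apply, smul_eq_mul]
      rw [mul_div_cancel₀ _ (hx0 t ht).ne']
    rw [h1, norm_smul, Real.norm_of_nonneg (hx0 t ht).le]
  have hquad : ∀ t, S ≤ t → ∀ A : Fin (n - 1) → Fin (n - 1) → ℝ, ‖A‖ ≤ C →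
      |dotF (appF A (μ t)) (μ t) / x t|
        ≤ ((n - 1 : ℕ) : ℝ) ^ 2 * C * (K * Real.exp (-k * t)) * ‖v t‖ := by
    intro t ht A hA
    rw [abs_div, abs_of_pos (hx0 t ht), div_le_iff₀ (hx0 t ht)]
    calc |dotF (appF A (μ t)) (μ t)| ≤ ((n - 1 : ℕ) : ℝ) ^ 2 * ‖A‖ * ‖μ t‖ ^ 2 :=
          abs_dotF_appF_le _ _
      _ ≤ ((n - 1 : ℕ) : ℝ) ^ 2 * C * (‖μ t‖ * (x t * ‖v t‖)) := by
          rw [sq ‖μ t‖, ← hμv t ht]; gcongr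
      _ ≤ ((n - 1 : ℕ) : ℝ) ^ 2 * C * (K * Real.exp (-k * t) * (x t * ‖v t‖)) := by
          have h1 := (hx0 t ht).le
          gcongr
          exact (hdecay t ht).2.2
      _ = _ := by ring
  have hHC : ∀ t, S ≤ t → ∀ i j, |H (x t) (y t) i j| ≤ C := by
    intro t ht i j
    refine abs_entry_le_of_dotF_appF_le (hsymm _ _) (fun w => ?_)
      (fun w => (hpos _ (hmem t ht) (y t) w).2) i j
    refine le_trans ?_ (hpos _ (hmem t ht) (y t) w).1
    exact mul_nonneg hc.le ((sq_nonneg _).trans (sq_norm_le_dotF w))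
  have hv' : ∀ t, S ≤ t → ∀ i, HasDerivAt (fun s => v s i) ((1 + lam t) * v t i
      - 1 / 2 * (dotF (appF (Hy' H i (x t) (y t)) (μ t)) (μ t) / x t)) t := fun t ht i =>
    (hquot t ht _ _ ((hsol t (h0 t ht)).2.2.2.1 i)).congr_deriv (by simp only [hv]; ring)
  have hv'le : ∀ t, S ≤ t → ∀ i, |(1 + lam t) * v t i
      - 1 / 2 * (dotF (appF (Hy' H i (x t) (y t)) (μ t)) (μ t) / x t)|
      ≤ (K + ((n - 1 : ℕ) : ℝ) ^ 2 * C * K) * Real.exp (-k * t) * ‖v t‖ := by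
    intro t ht i
    have h1 := hquad t ht _ ((hpart _ (hmem t ht) (y t)).2 i)
    have h2 : |(1 + lam t) * v t i| ≤ K * Real.exp (-k * t) * ‖v t‖ := by
      rw [abs_mul]
      exact mul_le_mul (hdecay t ht).2.1 (norm_le_pi_norm (v t) i) (abs_nonneg _) (by positivity)
    refine (abs_sub _ _).trans ?_
    rw [abs_mul (1 / 2), abs_of_pos (by norm_num : (0 : ℝ) < 1 / 2)]
    have h3 := abs_nonneg (dotF (appF (Hy' H i (x t) (y t)) (μ t)) (μ t) / x t)
    linarith
  obtain ⟨B, hB⟩ := exists_bound_of_abs_deriv_le_exp_mul_norm hk hv' hv'le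
  refine ⟨?_, ?_, exists_tendsto_of_abs_deriv_le_exp_mul_norm hk hv' hv'le, ?_⟩
  · have hy : ∀ i, ∃ L, Tendsto (fun t => y t i) atTop (nhds L) := fun i =>
      exists_tendsto_of_abs_deriv_le_exp (K := ((n - 1 : ℕ) : ℝ) * C * K) hk
        (fun t ht => hasDerivAt_pi.1 (hsol t (h0 t ht)).2.1 i) fun t ht => by
          refine (norm_le_pi_norm (appF (H (x t) (y t)) (μ t)) i).trans
            ((norm_appF_le hC.le (hHC t ht) _).trans ?_)
          rw [mul_assoc _ K]
          gcongr
          exact (hdecay t ht).2.2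
    choose L hL using hy
    exact ⟨L, tendsto_pi_nhds.2 hL⟩
  · refine exists_tendsto_of_abs_deriv_le_exp
      (K := ((n - 1 : ℕ) : ℝ) ^ 2 * C * K * B + ((n - 1 : ℕ) : ℝ) ^ 2 * C * K * B * ε) hk
      (fun t ht => hquot t ht _ _ ((hsol t (h0 t ht)).2.2.1.add_const 1)) fun t ht => ?_
    have hnorm : ‖H (x t) (y t)‖ ≤ C := (pi_norm_le_iff_of_nonneg hC.le).2 fun i =>
      (pi_norm_le_iff_of_nonneg hC.le).2 fun j => hHC t ht i j
    have hbound : ∀ A : Fin (n - 1) → Fin (n - 1) → ℝ, ‖A‖ ≤ C →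
        |dotF (appF A (μ t)) (μ t) / x t|
          ≤ ((n - 1 : ℕ) : ℝ) ^ 2 * C * K * B * Real.exp (-k * t) := fun A hA =>
      (hquad t ht A hA).trans ((mul_le_mul_of_nonneg_left (hB t ht) (by positivity)).trans_eq
        (by ring))
    have h1 := hbound _ hnorm
    have h2 := hbound _ (hpart _ (hmem t ht) (y t)).1
    have hne := (hx0 t ht).ne'
    calc _ = |-(dotF (appF (H (x t) (y t)) (μ t)) (μ t) / x t)
          - x t / 2 * (dotF (appF (Hx' H (x t) (y t)) (μ t)) (μ t) / x t)| := by
          congr 1; field_simp; ring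
      _ ≤ _ := (abs_sub _ _).trans (add_le_add (abs_neg _).le (abs_mul _ _).le)
      _ ≤ ((n - 1 : ℕ) : ℝ) ^ 2 * C * K * B * Real.exp (-k * t)
          + ε * (((n - 1 : ℕ) : ℝ) ^ 2 * C * K * B * Real.exp (-k * t)) := by
          have h3 : |x t / 2| ≤ ε := by
            rw [abs_of_pos (half_pos (hx0 t ht))]
            linarith [hx0 t ht, (hdecay t ht).1]
          gcongr
      _ = _ := by ring
  · refine exists_tendsto_of_abs_deriv_le_exp_mul_norm (K := K) (T := S) hk
      (g := fun t i => (1 + lam t) * ((x t)⁻¹ • ξ t) i) (fun t ht i => ?_) fun t ht i => ?_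
    · have := hquot t ht _ _ (hasDerivAt_pi.1 (hsol t (h0 t ht)).2.2.2.2 i)
      simp only [Pi.smul_apply, smul_eq_mul, inv_mul_eq_div] at this ⊢
      exact this.congr_deriv (by ring)
    · rw [abs_mul]
      exact mul_le_mul (hdecay t ht).2.1 (norm_le_pi_norm ((x t)⁻¹ • ξ t) i) (abs_nonneg _)
        (by positivity)
end
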